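/- arXiv:2409.03068 — 3 statements merged into one kernel-verified Lean document; each statement's English description precedes it below -/
import Mathlib

section
/- Let α = ⌊log₂(n−1)⌋. Then A₁ = 4, A₂ = 68, and for every integer n ≥ 3, the number A_n of distinct n×n patterns occurring in the 2-dimensional paperfolding sequence satisfies A_n = 12·n² + 24·n·2^α − 16·4^α − 4. -/
/-- The 16-letter alphabet 𝒜 = {A,…,P}. -/
inductive A16 : Type
  | A | B | C | D | E | F | G | H | I | J | K | L | M | N | O | P
  deriving DecidableEq

/-- The 2×2 block substitution μ on 𝒜 (rows top to bottom). -/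
def mu : A16 → Fin 2 → Fin 2 → A16
  | .A => ![![.A, .F], ![.G, .C]]
  | .B => ![![.A, .F], ![.H, .D]]
  | .C => ![![.B, .E], ![.G, .C]]
  | .D => ![![.B, .E], ![.H, .D]]
  | .E => ![![.A, .N], ![.G, .K]]
  | .F => ![![.A, .N], ![.H, .L]]
  | .G => ![![.B, .M], ![.G, .K]]
  | .H => ![![.B, .M], ![.H, .L]]
  | .I => ![![.I, .F], ![.O, .C]]
  | .J => ![![.I, .F], ![.P, .D]]
  | .K => ![![.J, .E], ![.O, .C]]
  | .L => ![![.J, .E], ![.P, .D]]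
  | .M => ![![.I, .N], ![.O, .K]]
  | .N => ![![.I, .N], ![.P, .L]]
  | .O => ![![.J, .M], ![.O, .K]]
  | .P => ![![.J, .M], ![.P, .L]]

/-- Entry version of μ, indexed by arbitrary naturals (via mod 2). -/
def muE (x : A16) (r c : ℕ) : A16 :=
  mu x ⟨r % 2, by omega⟩ ⟨c % 2, by omega⟩

/-- `superE n x` is the supertile μⁿ(x), a 2ⁿ×2ⁿ array over 𝒜,
given as a total function on ℕ × ℕ (only indices < 2ⁿ are relevant). -/
def superE : ℕ → A16 → ℕ → ℕ → A16
  | 0, x, _, _ => x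
  | n + 1, x, r, c => muE (superE n x (r / 2) (c / 2)) r c

/-- The supertile T_k = μᵏ(N). -/
def Tfun (k : ℕ) : ℕ → ℕ → A16 := superE k .N

/-- An m×n pattern over the alphabet α. -/
abbrev Pat (α : Type) (m n : ℕ) := Fin m → Fin n → α

/-- The set of m×n patterns occurring in the size×size array X. -/
def patIn {α : Type} (X : ℕ → ℕ → α) (size m n : ℕ) : Set (Pat α m n) :=
  { p | ∃ r c : ℕ, r + m ≤ size ∧ c + n ≤ size ∧
      ∀ (i : Fin m) (j : Fin n), p i j = X (r + i) (c + j) }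

/-- P(T, m×n) = ⋃ₖ P(T_k, m×n). -/
def PT (m n : ℕ) : Set (Pat A16 m n) := ⋃ k : ℕ, patIn (Tfun k) (2 ^ k) m n

/-- μ applied to an m×n pattern, as a total 2m×2n array on ℕ × ℕ
(indices are reduced mod the valid range; in range this is exactly μ(p)). -/
def muPatE {m n : ℕ} (p : Pat A16 m n) (r c : ℕ) : A16 :=
  if hm : 0 < m then
    if hn : 0 < n then
      muE (p ⟨r / 2 % m, Nat.mod_lt _ hm⟩ ⟨c / 2 % n, Nat.mod_lt _ hn⟩) r c
    else .A
  else .A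

/-- μ² applied to an m×n pattern, as a total 4m×4n array on ℕ × ℕ. -/
def mu2PatE {m n : ℕ} (p : Pat A16 m n) (r c : ℕ) : A16 :=
  muE (muPatE p (r / 2) (c / 2)) r c

/-- P_{i,j}(T, m×n) = { μ(x)[i,j,m×n] : x ∈ P(T,m×n) } (1-based corner (i,j)). -/
def Pij (i j m n : ℕ) : Set (Pat A16 m n) :=
  { q | ∃ x ∈ PT m n, ∀ (a : Fin m) (b : Fin n),
      q a b = muPatE x (i - 1 + a) (j - 1 + b) }

/-- Q_{i,j}(T, m×n) = { μ²(x)[i,j,m×n] : x ∈ P(T,m×n) } (1-based corner (i,j)). -/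
def Qij (i j m n : ℕ) : Set (Pat A16 m n) :=
  { q | ∃ x ∈ PT m n, ∀ (a : Fin m) (b : Fin n),
      q a b = mu2PatE x (i - 1 + a) (j - 1 + b) }

/-- The 2×2 block substitution φ from 𝒜 to ℬ = {0,1,2,3}. -/
def phi : A16 → Fin 2 → Fin 2 → Fin 4
  | .A => ![![0, 1], ![0, 0]]
  | .B => ![![0, 1], ![1, 1]]
  | .C => ![![1, 0], ![0, 0]]
  | .D => ![![1, 0], ![1, 1]]
  | .E => ![![0, 3], ![0, 2]]
  | .F => ![![0, 3], ![1, 3]]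
  | .G => ![![1, 2], ![0, 2]]
  | .H => ![![1, 2], ![1, 3]]
  | .I => ![![2, 1], ![2, 0]]
  | .J => ![![2, 1], ![3, 1]]
  | .K => ![![3, 0], ![2, 0]]
  | .L => ![![3, 0], ![3, 1]]
  | .M => ![![2, 3], ![2, 2]]
  | .N => ![![2, 3], ![3, 3]]
  | .O => ![![3, 2], ![2, 2]]
  | .P => ![![3, 2], ![3, 3]]

/-- Entry version of φ, indexed by arbitrary naturals (via mod 2). -/
def phiE (x : A16) (r c : ℕ) : Fin 4 :=
  phi x ⟨r % 2, by omega⟩ ⟨c % 2, by omega⟩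

/-- φ applied to an m×n pattern over 𝒜, as a total 2m×2n array on ℕ × ℕ. -/
def phiPatE {m n : ℕ} (p : Pat A16 m n) (r c : ℕ) : Fin 4 :=
  if hm : 0 < m then
    if hn : 0 < n then
      phiE (p ⟨r / 2 % m, Nat.mod_lt _ hm⟩ ⟨c / 2 % n, Nat.mod_lt _ hn⟩) r c
    else 0
  else 0

/-- φ(T_k), a 2^(k+1)×2^(k+1) array over ℬ. -/
def Sfun (k : ℕ) (r c : ℕ) : Fin 4 := phiE (Tfun k (r / 2) (c / 2)) r c

/-- P(S, m×n) = ⋃_{k≥1} P(φ(T_{k-1}), m×n). -/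
def PS (m n : ℕ) : Set (Pat (Fin 4) m n) :=
  ⋃ k : ℕ, patIn (Sfun k) (2 ^ (k + 1)) m n

/-- P_{i,j}(S, m×n) = { φ(x)[i,j,m×n] : x ∈ P(T,m×n) } (1-based corner (i,j)). -/
def PSij (i j m n : ℕ) : Set (Pat (Fin 4) m n) :=
  { q | ∃ x ∈ PT m n, ∀ (a : Fin m) (b : Fin n),
      q a b = phiPatE x (i - 1 + a) (j - 1 + b) }

/-- A_n = |P(S, n×n)|. -/
noncomputable def Acnt (n : ℕ) : ℕ := Nat.card (PS n n)

/-- a_{i,j}(n) = |P_{i,j}(T, n×n)|. -/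
noncomputable def aT (i j n : ℕ) : ℕ := Nat.card (Pij i j n n)

/-- b_{i,j}(n) = |P_{i,j}(T, n×(n+1))|. -/
noncomputable def bT (i j n : ℕ) : ℕ := Nat.card (Pij i j n (n + 1))

/-- c_{i,j}(n) = |P_{i,j}(T, (n+1)×n)|. -/
noncomputable def cT (i j n : ℕ) : ℕ := Nat.card (Pij i j (n + 1) n)

namespace Paperfolding

/-! ### The two bit planes -/

/-- High bit of the paperfolding sequence at row `y` and column `x`, both counted from `0`. If
`x = 2 ^ j * (2 * m + 1)` this is the parity of `y / 2 ^ (j + 1) + m`. -/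
def vert (y x : ℕ) : Bool :=
  if x % 2 = 1 then decide ((y / 2 + x / 2) % 2 = 1)
  else if _h : x = 0 then false
  else vert (y / 2) (x / 2)
termination_by x

/-- Low bit of the paperfolding sequence at row `y`, counted from `1`, and column `x`, counted
from `0`. If `y = 2 ^ j * (2 * m + 1)` this is the parity of `m + x / 2 ^ j`. -/
def horiz (y x : ℕ) : Bool :=
  if y % 2 = 1 then decide ((y / 2 + x) % 2 = 1)
  else if _h : y = 0 then false
  else horiz (y / 2) (x / 2)
termination_by y

lemma vert_odd {x : ℕ} (h : x % 2 = 1) (y : ℕ) :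
    vert y x = decide ((y / 2 + x / 2) % 2 = 1) := by
  rw [vert, if_pos h]

lemma vert_zero_right (y : ℕ) : vert y 0 = false := by
  rw [vert]; simp

lemma vert_even {x : ℕ} (h : x % 2 = 0) (y : ℕ) : vert y x = vert (y / 2) (x / 2) := by
  rcases Nat.eq_zero_or_pos x with rfl | hx
  · simp [vert_zero_right]
  · rw [vert, if_neg (by omega), dif_neg (by omega)]

lemma horiz_odd {y : ℕ} (h : y % 2 = 1) (x : ℕ) :
    horiz y x = decide ((y / 2 + x) % 2 = 1) := by
  rw [horiz, if_pos h]

lemma horiz_zero_left (x : ℕ) : horiz 0 x = false := by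
  rw [horiz]; simp

lemma horiz_even {y : ℕ} (h : y % 2 = 0) (x : ℕ) : horiz y x = horiz (y / 2) (x / 2) := by
  rcases Nat.eq_zero_or_pos y with rfl | hy
  · simp [horiz_zero_left]
  · rw [horiz, if_neg (by omega), dif_neg (by omega)]

lemma vert_two_pow_mul (k y x : ℕ) : vert y (2 ^ k * x) = vert (y / 2 ^ k) x := by
  induction k generalizing y with
  | zero => simp
  | succ k ih =>
    rw [show 2 ^ (k + 1) * x = 2 * (2 ^ k * x) by ring, vert_even (by omega),
      Nat.mul_div_cancel_left _ two_pos, ih, Nat.div_div_eq_div_mul, ← pow_succ']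

lemma horiz_two_pow_mul (k y x : ℕ) : horiz (2 ^ k * y) x = horiz y (x / 2 ^ k) := by
  induction k generalizing x with
  | zero => simp
  | succ k ih =>
    rw [show 2 ^ (k + 1) * y = 2 * (2 ^ k * y) by ring, horiz_even (by omega),
      Nat.mul_div_cancel_left _ two_pos, ih, Nat.div_div_eq_div_mul, ← pow_succ']

lemma two_pow_dvd_half {k x : ℕ} (h : x % 2 = 0) : 2 ^ k ∣ x / 2 ↔ 2 ^ (k + 1) ∣ x := by
  obtain ⟨z, rfl⟩ := Nat.dvd_of_mod_eq_zero h
  rw [Nat.mul_div_cancel_left _ two_pos, pow_succ', Nat.mul_dvd_mul_iff_left two_pos]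

lemma div_two_modEq {k u v : ℕ} (h : u ≡ v [MOD 2 ^ (k + 1)]) : u / 2 ≡ v / 2 [MOD 2 ^ k] := by
  unfold Nat.ModEq at *
  rw [pow_succ'] at h
  rw [← Nat.mod_mul_right_div_self, ← Nat.mod_mul_right_div_self, h]

lemma modEq_four {k u v : ℕ} (h : u ≡ v [MOD 2 ^ (k + 1 + 1)]) : u % 4 = v % 4 :=
  h.of_dvd ⟨2 ^ k, by ring⟩

lemma vert_congr {k y x y' x' : ℕ} (hx : ¬ 2 ^ k ∣ x) (hxx : x ≡ x' [MOD 2 ^ (k + 1)])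
    (hyy : y ≡ y' [MOD 2 ^ (k + 1)]) : vert y x = vert y' x' := by
  induction k generalizing y x y' x' with
  | zero => simp at hx
  | succ k ih =>
    have h4 : x % 4 = x' % 4 := modEq_four hxx
    have h4' : y % 4 = y' % 4 := modEq_four hyy
    rcases Nat.mod_two_eq_zero_or_one x with h | h
    · rw [vert_even h, vert_even (show x' % 2 = 0 by omega)]
      exact ih (by rwa [two_pow_dvd_half h]) (div_two_modEq hxx) (div_two_modEq hyy)
    · rw [vert_odd h, vert_odd (by omega)]
      congr 1
      apply propext
      omega

lemma horiz_congr {k y x y' x' : ℕ} (hy : ¬ 2 ^ k ∣ y) (hyy : y ≡ y' [MOD 2 ^ (k + 1)])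
    (hxx : x ≡ x' [MOD 2 ^ (k + 1)]) : horiz y x = horiz y' x' := by
  induction k generalizing y x y' x' with
  | zero => simp at hy
  | succ k ih =>
    have h4 : x % 4 = x' % 4 := modEq_four hxx
    have h4' : y % 4 = y' % 4 := modEq_four hyy
    rcases Nat.mod_two_eq_zero_or_one y with h | h
    · rw [horiz_even h, horiz_even (show y' % 2 = 0 by omega)]
      exact ih (by rwa [two_pow_dvd_half h]) (div_two_modEq hyy) (div_two_modEq hxx)
    · rw [horiz_odd h, horiz_odd (by omega)]
      congr 1
      apply propext
      omega

/-- Pack a high and a low bit into a letter of `Fin 4`. -/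
def pack : Bool → Bool → Fin 4
  | false, false => 0
  | false, true => 1
  | true, false => 2
  | true, true => 3

lemma pack_inj : ∀ {h l h' l' : Bool}, pack h l = pack h' l' ↔ h = h' ∧ l = l' := by decide

/-- The first bit in the numbering `A = 0000, …, P = 1111`. -/
def bitA : A16 → Bool
  | .I | .J | .K | .L | .M | .N | .O | .P => true
  | _ => false

/-- The second bit in the numbering `A = 0000, …, P = 1111`. -/
def bitB : A16 → Bool
  | .E | .F | .G | .H | .M | .N | .O | .P => true
  | _ => false

/-- The third bit in the numbering `A = 0000, …, P = 1111`. -/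
def bitC : A16 → Bool
  | .C | .D | .G | .H | .K | .L | .O | .P => true
  | _ => false

/-- The fourth bit in the numbering `A = 0000, …, P = 1111`. -/
def bitD : A16 → Bool
  | .B | .D | .F | .H | .J | .L | .N | .P => true
  | _ => false

lemma bits_mu (z : A16) (r c : Fin 2) :
    bitA (mu z r c) = (if c = 1 then bitB z else bitA z) ∧
    bitB (mu z r c) = decide (r ≠ c) ∧
    bitC (mu z r c) = decide (r = 1) ∧
    bitD (mu z r c) = (if r = 1 then bitD z else xor (bitC z) (decide (c = 1))) := by
  cases z <;> fin_cases r <;> fin_cases c <;> decide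

lemma phi_eq_pack (z : A16) (r c : Fin 2) :
    phi z r c = pack (if c = 1 then bitB z else bitA z)
      (if r = 1 then bitD z else xor (bitC z) (decide (c = 1))) := by
  cases z <;> fin_cases r <;> fin_cases c <;> decide

lemma fin_two_mk_mod_eq_one (r : ℕ) (h : r % 2 < 2) :
    ((⟨r % 2, h⟩ : Fin 2) = 1) = (r % 2 = 1) := by
  rw [Fin.ext_iff]; rfl

lemma bitB_Tfun_succ (k r c : ℕ) : bitB (Tfun (k + 1) r c) = decide ((r + c) % 2 = 1) := by
  simp only [Tfun, superE, muE, (bits_mu _ _ _).2.1]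
  congr 1
  rw [ne_eq, Fin.mk.injEq, eq_iff_iff]
  omega

lemma bitC_Tfun (k r c : ℕ) (h : k ≠ 0) : bitC (Tfun k r c) = decide (r % 2 = 1) := by
  obtain ⟨k, rfl⟩ := Nat.exists_eq_succ_of_ne_zero h
  simp only [Tfun, superE, muE, (bits_mu _ _ _).2.2.1, fin_two_mk_mod_eq_one]

lemma vert_eq_Tfun {k y x : ℕ} (hx : ¬ 2 ^ k ∣ x) :
    (if x % 2 = 1 then bitB (Tfun k (y / 2) (x / 2)) else bitA (Tfun k (y / 2) (x / 2))) =
      vert y x := by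
  induction k generalizing y x with
  | zero => simp at hx
  | succ k ih =>
    rcases Nat.mod_two_eq_zero_or_one x with h | h
    · rw [if_neg (by omega), vert_even h, ← ih (by rwa [two_pow_dvd_half h])]
      simp only [Tfun, superE, muE, (bits_mu _ _ _).1, fin_two_mk_mod_eq_one]
    · rw [if_pos h, vert_odd h, bitB_Tfun_succ]

lemma horiz_eq_Tfun {k y x : ℕ} (hy : ¬ 2 ^ k ∣ y + 1) :
    (if y % 2 = 1 then bitD (Tfun k (y / 2) (x / 2))
      else xor (bitC (Tfun k (y / 2) (x / 2))) (decide (x % 2 = 1))) = horiz (y + 1) x := by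
  induction k generalizing y x with
  | zero => simp at hy
  | succ k ih =>
    rcases Nat.mod_two_eq_zero_or_one y with h | h
    · rw [if_neg (by omega), horiz_odd (by omega), bitC_Tfun _ _ _ (by omega),
        show (y + 1) / 2 = y / 2 by omega, Nat.add_mod]
      rcases Nat.mod_two_eq_zero_or_one (y / 2) with h1 | h1 <;>
        rcases Nat.mod_two_eq_zero_or_one x with h2 | h2 <;> simp [h1, h2]
    · have e : (y + 1) / 2 = y / 2 + 1 := by omega
      have h' : ¬ 2 ^ k ∣ y / 2 + 1 := by rwa [← e, two_pow_dvd_half (by omega)]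
      rw [if_pos h, horiz_even (by omega), e, ← ih h']
      simp only [Tfun, superE, muE, (bits_mu _ _ _).2.2.2, fin_two_mk_mod_eq_one]

lemma Sfun_eq_pack {k y x : ℕ} (hx : ¬ 2 ^ k ∣ x) (hy : ¬ 2 ^ k ∣ y + 1) :
    Sfun k y x = pack (vert y x) (horiz (y + 1) x) := by
  simp only [Sfun, phiE, phi_eq_pack, fin_two_mk_mod_eq_one]
  rw [vert_eq_Tfun hx, horiz_eq_Tfun hy]

lemma Tfun_add_two {k r c : ℕ} (hr : r < 2 ^ k) (hc : c < 2 ^ k) :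
    Tfun (k + 2) r (c + 3 * 2 ^ k) = Tfun k r c := by
  induction k generalizing r c with
  | zero =>
    obtain rfl : r = 0 := by simpa using hr
    obtain rfl : c = 0 := by simpa using hc
    decide
  | succ k ih =>
    rw [pow_succ] at hr hc
    have e : (c + 3 * 2 ^ (k + 1)) / 2 = c / 2 + 3 * 2 ^ k := by rw [pow_succ]; omega
    have e' : (c + 3 * 2 ^ (k + 1)) % 2 = c % 2 := by rw [pow_succ]; omega
    have := ih (r := r / 2) (c := c / 2) (by omega) (by omega)
    simp only [Tfun, superE, muE] at this ⊢
    rw [← this, ← e]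
    simp only [e']

lemma Sfun_add_two {k y x : ℕ} (hy : y < 2 ^ (k + 1)) (hx : x < 2 ^ (k + 1)) :
    Sfun (k + 2) y (x + 3 * 2 ^ (k + 1)) = Sfun k y x := by
  rw [pow_succ] at *
  have e : (x + 3 * (2 ^ k * 2)) / 2 = x / 2 + 3 * 2 ^ k := by omega
  have e' : (x + 3 * (2 ^ k * 2)) % 2 = x % 2 := by omega
  simp only [Sfun, phiE, e, e', Tfun_add_two (show y / 2 < 2 ^ k by omega)
    (show x / 2 < 2 ^ k by omega)]

/-- The `n × n` window with top left corner in row `Y` and column `X`. -/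
def win (n Y X : ℕ) : Pat (Fin 4) n n :=
  fun i j => pack (vert (Y + i) (X + j)) (horiz (Y + i + 1) (X + j))

lemma win_eq_iff {n Y X Y' X' : ℕ} : win n Y X = win n Y' X' ↔ ∀ i < n, ∀ j < n,
    vert (Y + i) (X + j) = vert (Y' + i) (X' + j) ∧
    horiz (Y + i + 1) (X + j) = horiz (Y' + i + 1) (X' + j) := by
  constructor
  · intro h i hi j hj
    exact pack_inj.1 (congrFun (congrFun h ⟨i, hi⟩) ⟨j, hj⟩)
  · intro h
    funext i j
    exact pack_inj.2 (h i i.2 j j.2)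

lemma PS_eq_range (n : ℕ) :
    PS n n = Set.range (fun p : ℕ × ℕ => win n p.1 (p.2 + 1)) := by
  ext w
  simp only [PS, patIn, Set.mem_iUnion, Set.mem_ofPred_eq, Set.mem_range]
  constructor
  · rintro ⟨k, r, c, hr, hc, hw⟩
    have hpos : 0 < 2 ^ (k + 1) := by positivity
    refine ⟨(r, c + 3 * 2 ^ (k + 1) - 1), ?_⟩
    funext i j
    have hi := i.2
    have hj := j.2
    have e : c + 3 * 2 ^ (k + 1) - 1 + 1 + j = c + j + 3 * 2 ^ (k + 1) := by omega
    have h4 : 2 ^ (k + 2) = 2 * 2 ^ (k + 1) := by ring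
    rw [hw, ← Sfun_add_two (by omega) (by omega), Sfun_eq_pack, win, e]
    · rintro ⟨z, hz⟩
      rw [h4] at hz
      have h1 : z < 2 := by
        by_contra! h
        nlinarith [Nat.pos_of_neZero (2 ^ (k + 1))]
      interval_cases z <;> omega
    · intro h
      have := Nat.le_of_dvd (by omega) h
      omega
  · rintro ⟨⟨Y, X⟩, rfl⟩
    have hlt : Y + X + n + 2 < 2 ^ (Y + X + n + 2) := Nat.lt_two_pow_self
    refine ⟨Y + X + n + 2, Y, X + 1, by rw [pow_succ]; omega, by rw [pow_succ]; omega, ?_⟩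
    intro i j
    have hi := i.2
    have hj := j.2
    rw [Sfun_eq_pack, win]
    · intro h
      have := Nat.le_of_dvd (by omega) h
      omega
    · intro h
      have := Nat.le_of_dvd (by omega) h
      omega

/-! ### A window determines its position modulo a power of two -/

lemma vert_two_mul_add_one (m x : ℕ) : vert (2 * m + 1) x = vert (2 * m) x := by
  have e : (2 * m + 1) / 2 = 2 * m / 2 := by omega
  rcases Nat.mod_two_eq_zero_or_one x with h | h
  · rw [vert_even h, vert_even h, e]
  · rw [vert_odd h, vert_odd h, e]

lemma horiz_two_mul_add_one {y : ℕ} (hy : y % 2 = 0) (m : ℕ) :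
    horiz y (2 * m + 1) = horiz y (2 * m) := by
  rw [horiz_even hy, horiz_even hy, show (2 * m + 1) / 2 = 2 * m / 2 by omega]

lemma mod_four_of_vert_ne {y x : ℕ} (hy : y % 2 = 1) (hx : x % 2 = 0)
    (h : vert y x ≠ vert (y + 1) x) : y % 4 = 3 := by
  by_contra h4
  refine h ?_
  rw [vert_even hx, vert_even hx, show y / 2 = 2 * (y / 4) by omega,
    show (y + 1) / 2 = 2 * (y / 4) + 1 by omega, vert_two_mul_add_one]

lemma not_even_odd_of_row {Y X Y' X' : ℕ} (hY : Y % 2 = 0) (hY' : Y' % 2 = 1)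
    (h : ∀ j < 3, horiz (Y + 1) (X + j) = horiz (Y' + 1) (X' + j)) : False := by
  have h1 := h (X' % 2) (by omega)
  have h2 := h (X' % 2 + 1) (by omega)
  rw [show X' + (X' % 2 + 1) = 2 * (X' / 2 + X' % 2) + 1 by omega,
    horiz_two_mul_add_one (by omega), show 2 * (X' / 2 + X' % 2) = X' + X' % 2 by omega, ← h1,
    horiz_odd (by omega), horiz_odd (by omega), decide_eq_decide] at h2
  omega

lemma not_odd_even_of_square {Y X Y' X' : ℕ} (hY : Y % 2 = Y' % 2) (hX : X % 2 = 1)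
    (hX' : X' % 2 = 0)
    (h : ∀ i < 3, ∀ j < 3, vert (Y + i) (X + j) = vert (Y' + i) (X' + j) ∧
      horiz (Y + i + 1) (X + j) = horiz (Y' + i + 1) (X' + j)) : False := by
  obtain ⟨i, hi, hodd⟩ : ∃ i < 2, (Y + i) % 2 = 1 := ⟨1 - Y % 2, by omega, by omega⟩
  have flip : ∀ {y x : ℕ}, y % 2 = 1 → x % 2 = 1 → vert y x ≠ vert (y + 1) x := by
    intro y x hy hx
    rw [vert_odd hx, vert_odd hx, ne_eq, decide_eq_decide]
    omega
  have f0 := flip hodd (show (X + 0) % 2 = 1 by omega)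
  have f1 := flip (show (Y' + i) % 2 = 1 by omega) (show (X' + 1) % 2 = 1 by omega)
  rw [add_assoc, (h i (by omega) 0 (by omega)).1, (h (i + 1) (by omega) 0 (by omega)).1] at f0
  rw [add_assoc, ← (h i (by omega) 1 (by omega)).1, ← (h (i + 1) (by omega) 1 (by omega)).1] at f1
  have m0 := mod_four_of_vert_ne (by omega) (by omega) f0
  have m1 := mod_four_of_vert_ne hodd (by omega) f1
  have hr := (h (Y % 2) (by omega) 0 (by omega)).2
  rw [horiz_odd (by omega), horiz_odd (by omega), decide_eq_decide] at hr
  omega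

lemma modEq_two_of_square {Y X Y' X' : ℕ}
    (h : ∀ i < 3, ∀ j < 3, vert (Y + i) (X + j) = vert (Y' + i) (X' + j) ∧
      horiz (Y + i + 1) (X + j) = horiz (Y' + i + 1) (X' + j)) :
    Y ≡ Y' [MOD 2] ∧ X ≡ X' [MOD 2] := by
  have hY : Y % 2 = Y' % 2 := by
    have h1 := fun a b => not_even_odd_of_row a b fun j hj => (h 0 (by omega) j hj).2
    have h2 := fun a b => not_even_odd_of_row a b fun j hj => ((h 0 (by omega) j hj).2).symm
    by_contra hne
    rcases Nat.mod_two_eq_zero_or_one Y with hY | hY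
    · exact h1 hY (by omega)
    · exact h2 (by omega) hY
  refine ⟨hY, ?_⟩
  have h1 := fun a b => not_odd_even_of_square hY a b h
  have h2 := fun a b => not_odd_even_of_square hY.symm a b
    fun i hi j hj => ⟨(h i hi j hj).1.symm, (h i hi j hj).2.symm⟩
  by_contra hne
  unfold Nat.ModEq at hne
  rcases Nat.mod_two_eq_zero_or_one X with hX | hX
  · exact h2 (by omega) hX
  · exact h1 hX (by omega)

lemma exists_odd_multiple {P Z Z' : ℕ} (hP : 0 < P) (h : Z ≡ Z' [MOD 2 * P]) :
    ∃ j < 2 * P, ∃ w w', Z + j = P * (2 * w + 1) ∧ Z' + j = P * (2 * w' + 1) := by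
  have hr := Nat.mod_lt Z (show 0 < 2 * P by omega)
  have e := Nat.mod_add_div Z (2 * P)
  have e' := Nat.mod_add_div Z' (2 * P)
  rw [← h] at e'
  rcases le_or_gt (Z % (2 * P)) P with hle | hgt
  · refine ⟨P - Z % (2 * P), by omega, Z / (2 * P), Z' / (2 * P), ?_, ?_⟩
    all_goals rw [mul_add, ← mul_assoc, mul_comm P 2]; omega
  · refine ⟨3 * P - Z % (2 * P), by omega, Z / (2 * P) + 1, Z' / (2 * P) + 1, ?_, ?_⟩
    all_goals rw [mul_add, mul_add, mul_add, ← mul_assoc, mul_comm P 2]; omega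

lemma modEq_of_odd_multiple {P Z Z' j w w' : ℕ} (h : Z + j = P * (2 * w + 1))
    (h' : Z' + j = P * (2 * w' + 1)) (hw : w ≡ w' [MOD 2]) : Z ≡ Z' [MOD 2 * (2 * P)] := by
  refine Nat.ModEq.add_right_cancel' j ?_
  rw [h, h', show 2 * (2 * P) = P * (2 * 2) by ring]
  exact ((hw.mul_left' 2).add_right 1).mul_left' P

lemma div_modEq_two {P x x' : ℕ} (h : x ≡ x' [MOD 2 * P]) : x / P ≡ x' / P [MOD 2] := by
  unfold Nat.ModEq at *
  rw [mul_comm] at h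
  rw [← Nat.mod_mul_right_div_self, ← Nat.mod_mul_right_div_self, h]

lemma win_modEq {n k Y X Y' X' : ℕ} (hk : 2 ^ k < n) (hn : 3 ≤ n)
    (h : win n Y X = win n Y' X') :
    Y ≡ Y' [MOD 2 ^ (k + 1)] ∧ X ≡ X' [MOD 2 ^ (k + 1)] := by
  rw [win_eq_iff] at h
  induction k with
  | zero => exact modEq_two_of_square fun i hi j hj => h i (by omega) j (by omega)
  | succ k ih =>
    rw [pow_succ'] at hk ⊢
    obtain ⟨hY, hX⟩ := ih (by omega)
    rw [pow_succ'] at hY hX ⊢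
    have hP : 0 < 2 ^ k := by positivity
    have hY4 : Y ≡ Y' [MOD 2 * (2 * 2 ^ k)] := by
      obtain ⟨i, hi, w, w', e, e'⟩ := exists_odd_multiple hP (hY.add_right 1)
      refine Nat.ModEq.add_right_cancel' 1 (modEq_of_odd_multiple e e' ?_)
      have hc := (h i (by omega) 0 (by omega)).2
      have hd := div_modEq_two hX
      rw [add_right_comm, e, add_right_comm, e', horiz_two_pow_mul, horiz_two_pow_mul,
        horiz_odd (by omega), horiz_odd (by omega), decide_eq_decide] at hc
      unfold Nat.ModEq at *
      simp only [add_zero] at hc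
      omega
    refine ⟨hY4, ?_⟩
    obtain ⟨j, hj, w, w', e, e'⟩ := exists_odd_multiple hP hX
    refine modEq_of_odd_multiple e e' ?_
    have hc := (h 0 (by omega) j (by omega)).1
    have hd := div_modEq_two hY4
    rw [e, e', vert_two_pow_mul, vert_two_pow_mul, vert_odd (by omega), vert_odd (by omega),
      decide_eq_decide, Nat.div_div_eq_div_mul, Nat.div_div_eq_div_mul, mul_comm (2 ^ k) 2] at hc
    unfold Nat.ModEq at *
    simp only [add_zero] at hc
    omega

/-! ### Windows in terms of the nearest coarse crossing -/

/-- The bits seen around a crossing: the column through it above and below, the row through it to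
the left and to the right, and the parities of the sum of its coordinates and of its row. -/
abbrev Data := Bool × Bool × Bool × Bool × Bool × Bool

/-- The data at row `y` (counted from `1`) and column `x`. -/
def crossing (y x : ℕ) : Data :=
  (vert (y - 1) x, vert y x, horiz y (x - 1), horiz y x,
    decide ((x + y) % 2 = 1), decide (y % 2 = 1))

/-- The high bit in cell `(i, j)` of a window of size at most `2 * q`, where `q` is a power of two,
whose distances to the next row and column divisible by `2 * q` are `b` and `a`. -/
def vertAt (q a b : ℕ) (D : Data) (i j : ℕ) : Bool :=
  if j = a then if i ≤ b then D.1 else D.2.1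
  else if j = a + q ∨ j + q = a then
    xor D.2.2.2.2.1 (xor (decide (j + q = a)) (decide (i ≤ b)))
  else vert (2 * q + i - (b + 1)) (2 * q + j - a)

/-- The low bit in cell `(i, j)` of a window of size at most `2 * q`, where `q` is a power of two,
whose distances to the next row and column divisible by `2 * q` are `b` and `a`. -/
def horizAt (q a b : ℕ) (D : Data) (i j : ℕ) : Bool :=
  if i = b then if j < a then D.2.2.1 else D.2.2.2.1
  else if i = b + q ∨ i + q = b then
    xor D.2.2.2.2.2 (xor (decide (i + q = b)) (decide ((2 * q + j - a) / q % 2 = 1)))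
  else horiz (2 * q + i - b) (2 * q + j - a)

lemma div_eq_of_eq_mul_add {m Q d r : ℕ} (h : m = Q * d + r) (hr : r < Q) : m / Q = d := by
  rw [h, Nat.mul_add_div (by omega), Nat.div_eq_of_lt hr, add_zero]

lemma offset_of_dvd {q X a x j : ℕ} (ha : a < 2 * q) (hj : j < 2 * q) (hX : X + a = 2 * q * x)
    (h : q ∣ X + j) : j = a ∨ j = a + q ∨ j + q = a := by
  have hd : (q : ℤ) ∣ (j : ℤ) - a := by
    obtain ⟨z, hz⟩ := h
    refine ⟨z - 2 * x, ?_⟩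
    zify at hz hX
    linear_combination hz - hX
  obtain ⟨c, hc⟩ := hd
  have h1 : c < 2 := by by_contra! hcc; nlinarith
  have h2 : -2 < c := by by_contra! hcc; nlinarith
  interval_cases c <;> omega

variable {k a b x y X Y i j : ℕ}

lemma vert_eq_vertAt (ha : a < 2 * 2 ^ k) (hb : b < 2 * 2 ^ k)
    (hi : i < 2 * 2 ^ k) (hj : j < 2 * 2 ^ k)
    (hX : X + a = 2 * 2 ^ k * (x + 1)) (hY : Y + 1 + b = 2 * 2 ^ k * (y + 1)) :
    vert (Y + i) (X + j) = vertAt (2 ^ k) a b (crossing (y + 1) (x + 1)) i j := by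
  have hq : 0 < 2 ^ k := by positivity
  have hXe := hX
  have hYe := hY
  rw [mul_add_one] at hXe hYe
  have hdiv : (Y + i) / (2 * 2 ^ k) = if i ≤ b then y else y + 1 := by
    split_ifs with hib
    · exact div_eq_of_eq_mul_add (r := 2 * 2 ^ k + i - (b + 1)) (by omega) (by omega)
    · exact div_eq_of_eq_mul_add (r := i - (b + 1)) (by rw [mul_add_one]; omega) (by omega)
  simp only [vertAt, crossing]
  split_ifs with h1 h2 h3
  · rw [show X + j = 2 ^ (k + 1) * (x + 1) by rw [pow_succ', ← hX, h1], vert_two_pow_mul, pow_succ',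
      hdiv, if_pos h2, Nat.add_sub_cancel]
  · rw [show X + j = 2 ^ (k + 1) * (x + 1) by rw [pow_succ', ← hX, h1], vert_two_pow_mul, pow_succ',
      hdiv, if_neg h2]
  · obtain h3 | h3 := h3
    · rw [show X + j = 2 ^ k * (2 * (x + 1) + 1) by
        rw [mul_add_one, ← mul_assoc, mul_comm (2 ^ k) 2, ← hX]; omega, vert_two_pow_mul,
        vert_odd (by omega), Nat.div_div_eq_div_mul, mul_comm (2 ^ k) 2, hdiv,
        decide_eq_false (show ¬ j + 2 ^ k = a by omega)]
      rw [Bool.eq_iff_iff]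
      split_ifs with hib <;> simp [hib] <;> omega
    · rw [show X + j = 2 ^ k * (2 * x + 1) by
        rw [mul_add_one, ← mul_assoc, mul_comm (2 ^ k) 2]; omega, vert_two_pow_mul,
        vert_odd (by omega), Nat.div_div_eq_div_mul, mul_comm (2 ^ k) 2, hdiv, decide_eq_true h3]
      rw [Bool.eq_iff_iff]
      split_ifs with hib <;> simp [hib] <;> omega
  · refine vert_congr (k := k) (fun hd => ?_) ?_ ?_
    · rcases offset_of_dvd ha hj hX hd with h | h <;> tauto
    · rw [pow_succ', show X + j = 2 * 2 ^ k + j - a + 2 * 2 ^ k * x by omega]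
      simp [Nat.ModEq]
    · rw [pow_succ', show Y + i = 2 * 2 ^ k + i - (b + 1) + 2 * 2 ^ k * y by omega]
      simp [Nat.ModEq]

lemma horiz_eq_horizAt (ha : a < 2 * 2 ^ k) (hb : b < 2 * 2 ^ k)
    (hi : i < 2 * 2 ^ k) (hj : j < 2 * 2 ^ k)
    (hX : X + a = 2 * 2 ^ k * (x + 1)) (hY : Y + 1 + b = 2 * 2 ^ k * (y + 1)) :
    horiz (Y + i + 1) (X + j) = horizAt (2 ^ k) a b (crossing (y + 1) (x + 1)) i j := by
  have hq : 0 < 2 ^ k := by positivity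
  have hXe := hX
  have hYe := hY
  rw [mul_add_one] at hXe hYe
  have hdiv : (X + j) / (2 * 2 ^ k) = if j < a then x else x + 1 := by
    split_ifs with hja
    · exact div_eq_of_eq_mul_add (r := 2 * 2 ^ k + j - a) (by omega) (by omega)
    · exact div_eq_of_eq_mul_add (r := j - a) (by rw [mul_add_one]; omega) (by omega)
  have hmod : (X + j) / 2 ^ k % 2 = (2 * 2 ^ k + j - a) / 2 ^ k % 2 := by
    refine div_modEq_two ?_
    rw [show X + j = 2 * 2 ^ k + j - a + 2 * 2 ^ k * x by omega]
    simp [Nat.ModEq]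
  rw [add_right_comm]
  simp only [horizAt, crossing]
  split_ifs with h1 h2 h3
  · rw [show Y + 1 + i = 2 ^ (k + 1) * (y + 1) by rw [pow_succ', ← hY, h1], horiz_two_pow_mul,
      pow_succ', hdiv, if_pos h2, Nat.add_sub_cancel]
  · rw [show Y + 1 + i = 2 ^ (k + 1) * (y + 1) by rw [pow_succ', ← hY, h1], horiz_two_pow_mul,
      pow_succ', hdiv, if_neg h2]
  · obtain h3 | h3 := h3
    · rw [show Y + 1 + i = 2 ^ k * (2 * (y + 1) + 1) by
        rw [mul_add_one, ← mul_assoc, mul_comm (2 ^ k) 2, ← hY]; omega, horiz_two_pow_mul,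
        horiz_odd (by omega), ← hmod, decide_eq_false (show ¬ i + 2 ^ k = b by omega)]
      rw [Bool.eq_iff_iff]
      simp
      omega
    · rw [show Y + 1 + i = 2 ^ k * (2 * y + 1) by
        rw [mul_add_one, ← mul_assoc, mul_comm (2 ^ k) 2]; omega, horiz_two_pow_mul,
        horiz_odd (by omega), ← hmod, decide_eq_true h3]
      rw [Bool.eq_iff_iff]
      simp
      omega
  · refine horiz_congr (k := k) (fun hd => ?_) ?_ ?_
    · rcases offset_of_dvd hb hi hY hd with h | h <;> tauto
    · rw [pow_succ', show Y + 1 + i = 2 * 2 ^ k + i - b + 2 * 2 ^ k * y by omega]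
      simp [Nat.ModEq]
    · rw [pow_succ', show X + j = 2 * 2 ^ k + j - a + 2 * 2 ^ k * x by omega]
      simp [Nat.ModEq]

/-- The window of size at most `2 * q` at distances `b` and `a` from a crossing with data `D`. -/
def patternAt (q n b a : ℕ) (D : Data) : Pat (Fin 4) n n :=
  fun i j => pack (vertAt q a b D i j) (horizAt q a b D i j)

/-- The distance from `Z + 1` to the next multiple of `Q`. -/
def gap (Q Z : ℕ) : ℕ := Q - 1 - Z % Q

lemma gap_lt {Q : ℕ} (hQ : 0 < Q) (Z : ℕ) : gap Q Z < Q := by unfold gap; omega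

lemma add_gap {Q : ℕ} (hQ : 0 < Q) (Z : ℕ) : Z + 1 + gap Q Z = Q * (Z / Q + 1) := by
  have h1 := Nat.mod_lt Z hQ
  have h2 := Nat.mod_add_div Z Q
  rw [mul_add_one]
  unfold gap
  omega

lemma exists_gap_eq {Q a : ℕ} (ha : a < Q) (x : ℕ) : ∃ Z, gap Q Z = a ∧ Z / Q = x := by
  refine ⟨Q * x + (Q - 1 - a), ?_, div_eq_of_eq_mul_add rfl (by omega)⟩
  rw [gap, Nat.mul_add_mod, Nat.mod_eq_of_lt (by omega)]
  omega

lemma win_cell_eq {n : ℕ} (hn : n ≤ 2 * 2 ^ k) (hi : i < n) (hj : j < n) (Y X : ℕ) :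
    vert (Y + i) (X + 1 + j) = vertAt (2 ^ k) (gap (2 * 2 ^ k) X) (gap (2 * 2 ^ k) Y)
      (crossing (Y / (2 * 2 ^ k) + 1) (X / (2 * 2 ^ k) + 1)) i j ∧
    horiz (Y + i + 1) (X + 1 + j) = horizAt (2 ^ k) (gap (2 * 2 ^ k) X) (gap (2 * 2 ^ k) Y)
      (crossing (Y / (2 * 2 ^ k) + 1) (X / (2 * 2 ^ k) + 1)) i j := by
  have hQ : 0 < 2 * 2 ^ k := by positivity
  exact ⟨vert_eq_vertAt (gap_lt hQ X) (gap_lt hQ Y) (by omega) (by omega) (add_gap hQ X)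
      (add_gap hQ Y),
    horiz_eq_horizAt (gap_lt hQ X) (gap_lt hQ Y) (by omega) (by omega) (add_gap hQ X)
      (add_gap hQ Y)⟩

lemma win_eq_patternAt {n : ℕ} (hn : n ≤ 2 * 2 ^ k) (Y X : ℕ) :
    win n Y (X + 1) = patternAt (2 ^ k) n (gap (2 * 2 ^ k) Y) (gap (2 * 2 ^ k) X)
      (crossing (Y / (2 * 2 ^ k) + 1) (X / (2 * 2 ^ k) + 1)) := by
  funext i j
  obtain ⟨h1, h2⟩ := win_cell_eq hn i.2 j.2 Y X
  rw [win, patternAt, h1, h2]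

/-! ### The data that occur at crossings -/

/-- The data of crossings: exactly one of the two lines through a crossing changes there; it is the
row if the row is odd, and the column if the row is even and the column is odd. -/
def admissible : Finset Data :=
  {D | (D.1 ≠ D.2.1 ↔ D.2.2.1 = D.2.2.2.1) ∧ (D.2.2.2.2.2 = true → D.2.2.1 ≠ D.2.2.2.1) ∧
    (D.2.2.2.2.1 = true → D.2.2.2.2.2 = false → D.1 ≠ D.2.1)}

lemma horiz_pred_ne {y x : ℕ} (hy : y % 2 = 1) (hx : 0 < x) : horiz y (x - 1) ≠ horiz y x := by
  rw [horiz_odd hy, horiz_odd hy, ne_eq, decide_eq_decide]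
  omega

lemma vert_pred_eq {y x : ℕ} (hy : y % 2 = 1) : vert (y - 1) x = vert y x := by
  obtain ⟨m, rfl⟩ := Nat.odd_iff.2 hy
  rw [Nat.add_sub_cancel, vert_two_mul_add_one]

lemma vert_pred_ne {y x : ℕ} (hy : y % 2 = 0) (hx : x % 2 = 1) (h : 0 < y) :
    vert (y - 1) x ≠ vert y x := by
  rw [vert_odd hx, vert_odd hx, ne_eq, decide_eq_decide]
  omega

lemma horiz_pred_eq {y x : ℕ} (hy : y % 2 = 0) (hx : x % 2 = 1) :
    horiz y (x - 1) = horiz y x := by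
  obtain ⟨m, rfl⟩ := Nat.odd_iff.2 hx
  rw [Nat.add_sub_cancel, horiz_two_mul_add_one hy]

lemma vert_pred_ne_iff {y x : ℕ} (hy : 0 < y) (hx : 0 < x) :
    vert (y - 1) x ≠ vert y x ↔ horiz y (x - 1) = horiz y x := by
  induction y using Nat.strong_induction_on generalizing x with
  | _ y ih =>
    rcases Nat.mod_two_eq_zero_or_one y with hy2 | hy2
    · rcases Nat.mod_two_eq_zero_or_one x with hx2 | hx2
      · rw [vert_even hx2, vert_even hx2, horiz_even hy2, horiz_even hy2,
          show (y - 1) / 2 = y / 2 - 1 by omega, show (x - 1) / 2 = x / 2 - 1 by omega]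
        exact ih (y / 2) (by omega) (by omega) (by omega)
      · exact iff_of_true (vert_pred_ne hy2 hx2 hy) (horiz_pred_eq hy2 hx2)
    · exact iff_of_false (not_not.2 (vert_pred_eq hy2)) (horiz_pred_ne hy2 hx)

lemma crossing_mem_admissible (y x : ℕ) : crossing (y + 1) (x + 1) ∈ admissible := by
  simp only [admissible, crossing, Finset.mem_filter, Finset.mem_univ, true_and,
    decide_eq_true_eq, decide_eq_false_iff_not]
  exact ⟨vert_pred_ne_iff y.succ_pos x.succ_pos, fun h => horiz_pred_ne h x.succ_pos,
    fun h h' => vert_pred_ne (by omega) (by omega) y.succ_pos⟩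

lemma exists_crossing_eq : ∀ D ∈ admissible, ∃ y < 16, ∃ x < 16, crossing (y + 1) (x + 1) = D := by
  decide +kernel

lemma exists_position {Q b a : ℕ} (hb : b < Q) (ha : a < Q) {D : Data} (hD : D ∈ admissible) :
    ∃ Y X, gap Q Y = b ∧ gap Q X = a ∧ crossing (Y / Q + 1) (X / Q + 1) = D := by
  obtain ⟨y, -, x, -, h⟩ := exists_crossing_eq D hD
  obtain ⟨Y, hY, rfl⟩ := exists_gap_eq hb y
  obtain ⟨X, hX, rfl⟩ := exists_gap_eq ha x
  exact ⟨Y, X, hY, hX, h⟩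

/-! ### Windows of size at most two -/

lemma PS_eq_image {n : ℕ} (hn : n ≤ 2) :
    PS n n = ((Finset.range 2 ×ˢ Finset.range 2) ×ˢ admissible).image
      fun t => patternAt 1 n t.1.1 t.1.2 t.2 := by
  rw [PS_eq_range]
  ext w
  simp only [Set.mem_range, Finset.coe_image, Set.mem_image, Finset.mem_coe, Finset.mem_product,
    Finset.mem_range]
  have key := fun Y X => win_eq_patternAt (k := 0) (n := n) (by simpa using hn) Y X
  simp only [pow_zero, mul_one] at key
  constructor
  · rintro ⟨⟨Y, X⟩, rfl⟩
    exact ⟨((_, _), _), ⟨⟨gap_lt two_pos Y, gap_lt two_pos X⟩, crossing_mem_admissible _ _⟩,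
      (key Y X).symm⟩
  · rintro ⟨⟨⟨b, a⟩, D⟩, ⟨⟨hb, ha⟩, hD⟩, rfl⟩
    obtain ⟨Y, X, rfl, rfl, rfl⟩ := exists_position hb ha hD
    exact ⟨(Y, X), key Y X⟩

lemma Acnt_one : Acnt 1 = 4 := by
  rw [Acnt, PS_eq_image (by omega), Nat.card_coe_set_eq, Set.ncard_coe_finset]
  decide +kernel

lemma Acnt_two : Acnt 2 = 68 := by
  rw [Acnt, PS_eq_image (by omega), Nat.card_coe_set_eq, Set.ncard_coe_finset]
  decide +kernel

/-! ### The visible part of the data -/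

/-- The data with the bits erased that cannot be seen. The arguments say whether the even column,
its left neighbour and the odd column, the even row, its lower neighbour and the odd row meet the
window. -/
def mask (cE cL cO rE rB rO : Bool) (D : Data) : Data :=
  (cE && D.1, cE && rB && D.2.1, rE && cL && D.2.2.1, rE && cE && D.2.2.2.1,
    cO && D.2.2.2.2.1, rO && D.2.2.2.2.2)

/-- The part of the data visible in a window of size `n` at distances `b` and `a` from the
crossing. -/
def visible (q n b a : ℕ) : Data → Data :=
  mask (a < n) (0 < a) (q ≤ a ∨ a + q < n) (b < n) (b + 1 < n) (q ≤ b ∨ b + q < n)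

lemma vertAt_visible {q n : ℕ} (hi : i < n) (hj : j < n) (D : Data) :
    vertAt q a b (visible q n b a D) i j = vertAt q a b D i j := by
  simp only [vertAt, visible, mask]
  split_ifs with h1 h2 h3
  · simp [show a < n by omega]
  · simp [show a < n by omega, show b + 1 < n by omega]
  · simp [show q ≤ a ∨ a + q < n by omega]
  · rfl

lemma horizAt_visible {q n : ℕ} (hi : i < n) (hj : j < n) (D : Data) :
    horizAt q a b (visible q n b a D) i j = horizAt q a b D i j := by
  simp only [horizAt, visible, mask]
  split_ifs with h1 h2 h3
  · simp [show b < n by omega, show 0 < a by omega]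
  · simp [show b < n by omega, show a < n by omega]
  · simp [show q ≤ b ∨ b + q < n by omega]
  · rfl

lemma visible_eq_of_cells {q n : ℕ} (hq : 0 < q) (hqn : q < n) (ha : a < 2 * q) (hb : b < 2 * q)
    {D D' : Data}
    (hv : ∀ i < n, ∀ j < n, vertAt q a b D i j = vertAt q a b D' i j)
    (hh : ∀ i < n, ∀ j < n, horizAt q a b D i j = horizAt q a b D' i j) :
    visible q n b a D = visible q n b a D' := by
  have and_congr' : ∀ {p u v : Bool}, (p = true → u = v) → (p && u) = (p && v) := by decide
  simp only [visible, mask, Prod.mk.injEq]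
  refine ⟨and_congr' fun h => ?_, and_congr' fun h => ?_, and_congr' fun h => ?_,
    and_congr' fun h => ?_, and_congr' fun h => ?_, and_congr' fun h => ?_⟩
  · have h : a < n := by simpa using h
    simpa [vertAt] using hv 0 (by omega) a h
  · have h : a < n ∧ b + 1 < n := by simpa using h
    simpa [vertAt] using hv (b + 1) h.2 a h.1
  · have h : b < n ∧ 0 < a := by simpa using h
    simpa [horizAt, h.2] using hh b h.1 0 (by omega)
  · have h : b < n ∧ a < n := by simpa using h
    simpa [horizAt] using hh b h.1 a h.2
  · have h : q ≤ a ∨ a + q < n := by simpa using h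
    rcases h with h | h
    · have := hv 0 (by omega) (a - q) (by omega)
      simpa [vertAt, show a - q ≠ a by omega, show a - q + q = a by omega] using this
    · have := hv 0 (by omega) (a + q) h
      simpa [vertAt, hq.ne'] using this
  · have h : q ≤ b ∨ b + q < n := by simpa using h
    rcases h with h | h
    · have := hh (b - q) (by omega) 0 (by omega)
      simpa [horizAt, show b - q ≠ b by omega, show b - q + q = b by omega] using this
    · have := hh (b + q) h 0 (by omega)
      simpa [horizAt, hq.ne'] using this

/-- A complete invariant of the window of size `n` with top left corner in row `p.1` and column
`p.2 + 1`. -/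
def code (q n : ℕ) (p : ℕ × ℕ) : Σ _ : ℕ × ℕ, Data :=
  ⟨(gap (2 * q) p.1, gap (2 * q) p.2), visible q n (gap (2 * q) p.1) (gap (2 * q) p.2)
    (crossing (p.1 / (2 * q) + 1) (p.2 / (2 * q) + 1))⟩

lemma win_eq_iff_code_eq {n : ℕ} (hk : 2 ^ k < n) (hn : n ≤ 2 * 2 ^ k) (h3 : 3 ≤ n)
    (p p' : ℕ × ℕ) :
    win n p.1 (p.2 + 1) = win n p'.1 (p'.2 + 1) ↔ code (2 ^ k) n p = code (2 ^ k) n p' := by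
  have hQ : 0 < 2 * 2 ^ k := by positivity
  constructor
  · intro h
    obtain ⟨hY, hX⟩ := win_modEq hk h3 h
    replace hX := Nat.ModEq.add_right_cancel' 1 hX
    rw [pow_succ'] at hX hY
    have eb : gap (2 * 2 ^ k) p'.1 = gap (2 * 2 ^ k) p.1 := by unfold gap; rw [hY]
    have ea : gap (2 * 2 ^ k) p'.2 = gap (2 * 2 ^ k) p.2 := by unfold gap; rw [hX]
    rw [win_eq_iff] at h
    simp only [code, eb, ea]
    congr 1
    refine visible_eq_of_cells (by omega) hk (gap_lt hQ _) (gap_lt hQ _) ?_ ?_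
    · intro i hi j hj
      have := (h i hi j hj).1
      rwa [(win_cell_eq hn hi hj _ _).1, (win_cell_eq hn hi hj _ _).1, eb, ea] at this
    · intro i hi j hj
      have := (h i hi j hj).2
      rwa [(win_cell_eq hn hi hj _ _).2, (win_cell_eq hn hi hj _ _).2, eb, ea] at this
  · intro h
    simp only [code, Sigma.mk.injEq, Prod.mk.injEq, heq_eq_eq] at h
    obtain ⟨⟨eb, ea⟩, hD⟩ := h
    rw [win_eq_iff]
    intro i hi j hj
    rw [(win_cell_eq hn hi hj _ _).1, (win_cell_eq hn hi hj _ _).1,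
      (win_cell_eq hn hi hj _ _).2, (win_cell_eq hn hi hj _ _).2, ← vertAt_visible hi hj,
      ← horizAt_visible hi hj, hD, ← eb, ← ea, vertAt_visible hi hj, horizAt_visible hi hj]
    exact ⟨rfl, rfl⟩

lemma range_code {q : ℕ} (hq : 0 < q) (n : ℕ) :
    Set.range (code q n) = ((Finset.range (2 * q) ×ˢ Finset.range (2 * q)).sigma
      fun p => admissible.image (visible q n p.1 p.2) : Finset (Σ _ : ℕ × ℕ, Data)) := by
  have hQ : 0 < 2 * q := by omega
  ext ⟨⟨b, a⟩, D⟩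
  simp only [Set.mem_range, Finset.mem_coe, Finset.mem_sigma, Finset.mem_product, Finset.mem_range,
    Finset.mem_image]
  constructor
  · rintro ⟨p, hp⟩
    simp only [code, Sigma.mk.injEq, Prod.mk.injEq, heq_eq_eq] at hp
    obtain ⟨⟨rfl, rfl⟩, rfl⟩ := hp
    exact ⟨⟨gap_lt hQ _, gap_lt hQ _⟩, _, crossing_mem_admissible _ _, rfl⟩
  · rintro ⟨⟨hb, ha⟩, D, hD, rfl⟩
    obtain ⟨Y, X, rfl, rfl, rfl⟩ := exists_position hb ha hD
    exact ⟨(Y, X), rfl⟩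

lemma card_range_congr {α β γ : Type*} {f : α → β} {g : α → γ}
    (h : ∀ x y, f x = f y ↔ g x = g y) : Nat.card (Set.range f) = Nat.card (Set.range g) := by
  have hker : Setoid.ker f = Setoid.ker g := Setoid.ext h
  rw [← Nat.card_congr (Setoid.quotientKerEquivRange f), hker,
    Nat.card_congr (Setoid.quotientKerEquivRange g)]

/-- The number of visible parts of data, given which lines meet the window. -/
def visibleCount (cE cL cO rE rB rO : Bool) : ℕ :=
  (admissible.image (mask cE cL cO rE rB rO)).card

lemma Acnt_eq_sum {n : ℕ} (hk : 2 ^ k < n) (hn : n ≤ 2 * 2 ^ k) (h3 : 3 ≤ n) :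
    Acnt n = ∑ b ∈ Finset.range (2 * 2 ^ k), ∑ a ∈ Finset.range (2 * 2 ^ k),
      visibleCount (a < n) (0 < a) (2 ^ k ≤ a ∨ a + 2 ^ k < n) (b < n) (b + 1 < n)
        (2 ^ k ≤ b ∨ b + 2 ^ k < n) := by
  rw [Acnt, PS_eq_range, card_range_congr (win_eq_iff_code_eq hk hn h3), range_code (by positivity),
    Nat.card_coe_set_eq, Set.ncard_coe_finset, Finset.card_sigma, Finset.sum_product]
  rfl

/-! ### Evaluation of the count -/

lemma visibleCount_full_row : visibleCount true false true true true true = 20 ∧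
    visibleCount true true true true true true = 20 ∧
    visibleCount true true false true true true = 12 ∧
    visibleCount false true true true true true = 8 := by
  decide +kernel

lemma visibleCount_even_row : visibleCount true false true true true false = 16 ∧
    visibleCount true true true true true false = 16 ∧
    visibleCount true true false true true false = 8 ∧
    visibleCount false true true true true false = 4 := by
  decide +kernel

lemma visibleCount_last_row : visibleCount true false true true false true = 16 ∧
    visibleCount true true true true false true = 20 ∧
    visibleCount true true false true false true = 12 ∧
    visibleCount false true true true false true = 8 := by
  decide +kernel

lemma visibleCount_odd_row : visibleCount true false true false false true = 8 ∧
    visibleCount true true true false false true = 8 ∧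
    visibleCount true true false false false true = 4 ∧
    visibleCount false true true false false true = 4 := by
  decide +kernel

lemma sum_range_const {f : ℕ → ℕ} {m c : ℕ} (h : ∀ x < m, f x = c) :
    ∑ x ∈ Finset.range m, f x = m * c := by
  rw [Finset.sum_congr rfl fun x hx => h x (Finset.mem_range.1 hx)]
  simp

lemma sum_columns {q n s d : ℕ} (hq : q = s + 1 + d) (hn : n = 2 * s + 2 + d)
    (F : Bool → Bool → Bool → ℕ) :
    ∑ a ∈ Finset.range (2 * q), F (a < n) (0 < a) (q ≤ a ∨ a + q < n) =
      F true false true + (2 * s + 1) * F true true true + d * F true true false +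
        d * F false true true := by
  rw [show 2 * q = 1 + s + d + (s + 1) + d by omega, Finset.sum_range_add, Finset.sum_range_add,
    Finset.sum_range_add, Finset.sum_range_add, sum_range_const (c := F true false true),
    sum_range_const (c := F true true true), sum_range_const (c := F true true false),
    sum_range_const (c := F true true true), sum_range_const (c := F false true true)]
  · ring
  all_goals
    intro x hx
    congr 1 <;> simp <;> omega

lemma sum_rows {q n s d : ℕ} (hq : q = s + 1 + d) (hn : n = 2 * s + 2 + d)
    (G : Bool → Bool → Bool → ℕ) :
    ∑ b ∈ Finset.range (2 * q), G (b < n) (b + 1 < n) (q ≤ b ∨ b + q < n) =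
      (2 * s + 1) * G true true true + d * G true true false + G true false true +
        d * G false false true := by
  rw [show 2 * q = s + 1 + d + s + 1 + d by omega, Finset.sum_range_add, Finset.sum_range_add,
    Finset.sum_range_add, Finset.sum_range_add, sum_range_const (c := G true true true),
    sum_range_const (c := G true true false), sum_range_const (c := G true true true),
    sum_range_const (c := G true false true), sum_range_const (c := G false false true)]
  · ring
  all_goals
    intro x hx
    congr 1 <;> simp <;> omega

lemma Acnt_eq {n : ℕ} (hk : 2 ^ k < n) (hn : n ≤ 2 * 2 ^ k) (h3 : 3 ≤ n) :
    (Acnt n : ℤ) = 12 * (n : ℤ) ^ 2 + 24 * (n : ℤ) * 2 ^ k - 16 * 4 ^ k - 4 := by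
  obtain ⟨s, hs⟩ := Nat.exists_eq_add_of_lt hk
  obtain ⟨d, hd⟩ := Nat.exists_eq_add_of_le hn
  have hq : 2 ^ k = s + 1 + d := by omega
  have hn' : n = 2 * s + 2 + d := by omega
  obtain ⟨f1, f2, f3, f4⟩ := visibleCount_full_row
  obtain ⟨e1, e2, e3, e4⟩ := visibleCount_even_row
  obtain ⟨l1, l2, l3, l4⟩ := visibleCount_last_row
  obtain ⟨o1, o2, o3, o4⟩ := visibleCount_odd_row
  rw [Acnt_eq_sum hk hn h3]
  rw [Finset.sum_congr rfl fun b _ => sum_columns hq hn' fun cE cL cO =>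
      visibleCount cE cL cO (b < n) (b + 1 < n) (2 ^ k ≤ b ∨ b + 2 ^ k < n),
    sum_rows hq hn' fun rE rB rO => visibleCount true false true rE rB rO +
    (2 * s + 1) * visibleCount true true true rE rB rO + d * visibleCount true true false rE rB rO +
    d * visibleCount false true true rE rB rO]
  have hq' : (2 : ℤ) ^ k = s + 1 + d := by exact_mod_cast hq
  rw [show (4 : ℤ) ^ k = (2 ^ k) ^ 2 by rw [← pow_mul, mul_comm, pow_mul]; norm_num, hq', hn',
    f1, f2, f3, f4, e1, e2, e3, e4, l1, l2, l3, l4, o1, o2, o3, o4]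
  push_cast
  ring

end Paperfolding

/-- Theorem 1.1: A₁ = 4, A₂ = 68 and, for n ≥ 3,
A_n = 12·n² + 24·n·2^α − 16·4^α − 4 with α = ⌊log₂(n−1)⌋. -/
theorem paperfolding_pattern_complexity :
    Acnt 1 = 4 ∧ Acnt 2 = 68 ∧
    ∀ n : ℕ, 3 ≤ n →
      (Acnt n : ℤ) =
        12 * (n : ℤ) ^ 2 + 24 * (n : ℤ) * 2 ^ (Nat.log 2 (n - 1))
          - 16 * 4 ^ (Nat.log 2 (n - 1)) - 4 := by
  refine ⟨Paperfolding.Acnt_one, Paperfolding.Acnt_two, fun n hn => ?_⟩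
  have h1 := Nat.pow_log_le_self 2 (show n - 1 ≠ 0 by omega)
  have h2 := Nat.lt_pow_succ_log_self one_lt_two (n - 1)
  rw [Nat.succ_eq_add_one, pow_succ'] at h2
  exact Paperfolding.Acnt_eq (by omega) (by omega) hn
end

section
/- For every integer n ≥ 3, the number of n×n patterns of T equals the number of n×n patterns of S, i.e. |P(T, n×n)| = |P(S, n×n)|. -/
/-- The letter coding `𝒜 → ℬ` whose composition with `μ` is `φ`. -/
def letterCode : A16 → Fin 4
  | .A | .C | .E | .G => 0
  | .B | .D | .F | .H => 1
  | .I | .K | .M | .O => 2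
  | .J | .L | .N | .P => 3

/-- The low bit of the code of a letter. -/
def lowBit (x : A16) : ℕ := (letterCode x).val % 2

/-- The parity of the row in which a letter occurs in its parent block. -/
def rowBit : A16 → ℕ
  | .A | .B | .E | .F | .I | .J | .M | .N => 0
  | .C | .D | .G | .H | .K | .L | .O | .P => 1

theorem phiE_eq_letterCode_muE (x : A16) (r c : ℕ) :
    phiE x r c = letterCode (muE x r c) := by
  unfold phiE muE
  generalize (⟨r % 2, _⟩ : Fin 2) = i
  generalize (⟨c % 2, _⟩ : Fin 2) = j
  cases x <;> revert i j <;> decide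

theorem Sfun_eq_letterCode_Tfun (k r c : ℕ) : Sfun k r c = letterCode (Tfun (k + 1) r c) :=
  phiE_eq_letterCode_muE _ _ _

theorem rowBit_muE (x : A16) (r c : ℕ) : rowBit (muE x r c) = r % 2 := by
  have key : ∀ i j : Fin 2, rowBit (mu x i j) = i.val := by cases x <;> decide
  exact key _ _

theorem lowBit_muE_of_odd (x : A16) {r : ℕ} (c : ℕ) (hr : r % 2 = 1) :
    lowBit (muE x r c) = lowBit x := by
  have key : ∀ i j : Fin 2, i.val = 1 → lowBit (mu x i j) = lowBit x := by cases x <;> decide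
  exact key _ _ hr

theorem lowBit_muE_of_even (x : A16) {r : ℕ} (c : ℕ) (hr : r % 2 = 0) :
    lowBit (muE x r c) = (rowBit x + c) % 2 := by
  have key : ∀ i j : Fin 2, i.val = 0 → lowBit (mu x i j) = (rowBit x + j.val) % 2 := by
    cases x <;> decide
  exact (key _ _ hr).trans (Nat.add_mod_mod _ _ _)

/-- A letter is determined by its code and its position in its parent block. -/
theorem muE_eq_of_letterCode_eq {x y : A16} {r c r' c' : ℕ} (hr : r % 2 = r' % 2)
    (hc : c % 2 = c' % 2) (h : letterCode (muE x r c) = letterCode (muE y r' c')) :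
    muE x r c = muE y r' c' := by
  have key : ∀ i j : Fin 2, letterCode (mu x i j) = letterCode (mu y i j) →
      mu x i j = mu y i j := by
    cases x <;> cases y <;> decide
  unfold muE at h ⊢
  simp only [hr, hc] at h ⊢
  exact key _ _ h

theorem exists_rowBit_Tfun_eq (k : ℕ) : ∃ e : ℕ → ℕ, ∀ r c, rowBit (Tfun k r c) = e r := by
  cases k with
  | zero => exact ⟨fun _ => rowBit .N, fun _ _ => rfl⟩
  | succ k => exact ⟨fun r => r % 2, fun _ _ => rowBit_muE _ _ _⟩

/-- The constraints satisfied by the array of low bits of a supertile. -/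
structure IsLowBitArray (u : ℕ → ℕ → ℕ) : Prop where
  even_row : ∀ r c, r % 2 = 0 → u r c = (r / 2 + c) % 2
  odd_row : ∀ r c, r % 2 = 1 → c % 2 = 0 → u r (c + 1) = u r c
  alternating : ∀ r c, r % 4 = 1 → u r (c + 2) ≠ u r c

theorem isLowBitArray_Tfun (k : ℕ) : IsLowBitArray fun r c => lowBit (Tfun (k + 2) r c) where
  even_row r c hr := by
    change lowBit (muE (muE _ (r / 2) _) r c) = _
    rw [lowBit_muE_of_even _ _ hr, rowBit_muE]
    omega
  odd_row r c hr hc := by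
    change lowBit (muE (Tfun (k + 1) (r / 2) ((c + 1) / 2)) r (c + 1)) =
      lowBit (muE (Tfun (k + 1) (r / 2) (c / 2)) r c)
    rw [lowBit_muE_of_odd _ _ hr, lowBit_muE_of_odd _ _ hr, show (c + 1) / 2 = c / 2 by omega]
  alternating r c hr := by
    obtain ⟨e, he⟩ := exists_rowBit_Tfun_eq k
    have key (c : ℕ) : lowBit (Tfun (k + 2) r c) = (e (r / 2 / 2) + c / 2) % 2 := by
      change lowBit (muE (muE (Tfun k (r / 2 / 2) (c / 2 / 2)) (r / 2) (c / 2)) r c) = _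
      rw [lowBit_muE_of_odd _ _ (by omega), lowBit_muE_of_even _ _ (by omega), he]
    rw [key, key]
    omega

theorem IsLowBitArray.ne_of_even_row {u : ℕ → ℕ → ℕ} (hu : IsLowBitArray u) {r : ℕ} (c : ℕ)
    (hr : r % 2 = 0) : u r (c + 1) ≠ u r c := by
  rw [hu.even_row _ _ hr, hu.even_row _ _ hr]
  omega

theorem IsLowBitArray.eq_or_eq_of_odd_row {u : ℕ → ℕ → ℕ} (hu : IsLowBitArray u) {r : ℕ} (c : ℕ)
    (hr : r % 2 = 1) : u r (c + 1) = u r c ∨ u r (c + 2) = u r (c + 1) :=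
  (Nat.mod_two_eq_zero_or_one c).imp (hu.odd_row r c hr) fun hc =>
    hu.odd_row r (c + 1) hr (by omega)

/-- A window of width `3` determines the parity of its row. -/
theorem IsLowBitArray.row_parity_eq {u v : ℕ → ℕ → ℕ} (hu : IsLowBitArray u)
    (hv : IsLowBitArray v) {r c r' c' : ℕ} (h : ∀ j < 3, u r (c + j) = v r' (c' + j)) :
    r % 2 = r' % 2 := by
  have h0 : u r c = v r' c' := h 0 (by norm_num)
  have h1 := h 1 (by norm_num)
  have h2 := h 2 (by norm_num)
  rcases Nat.mod_two_eq_zero_or_one r with hr | hr <;>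
    rcases Nat.mod_two_eq_zero_or_one r' with hr' | hr'
  · omega
  · have := hu.ne_of_even_row c hr
    have : u r (c + 2) ≠ u r (c + 1) := hu.ne_of_even_row (c + 1) hr
    have := hv.eq_or_eq_of_odd_row c' hr'
    omega
  · have := hu.eq_or_eq_of_odd_row c hr
    have := hv.ne_of_even_row c' hr'
    have : v r' (c' + 2) ≠ v r' (c' + 1) := hv.ne_of_even_row (c' + 1) hr'
    omega
  · omega

/-- A window of width `3` in a row congruent to `1` modulo `4` determines the parity of its
column. -/
theorem IsLowBitArray.column_parity_eq {u v : ℕ → ℕ → ℕ} (hu : IsLowBitArray u)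
    (hv : IsLowBitArray v) {r c r' c' : ℕ} (hr : r % 4 = 1)
    (h : ∀ j < 3, u r (c + j) = v r' (c' + j)) : c % 2 = c' % 2 := by
  have hr' := hu.row_parity_eq hv h
  have h0 : u r c = v r' c' := h 0 (by norm_num)
  have h1 := h 1 (by norm_num)
  have h2 := h 2 (by norm_num)
  have halt := hu.alternating r c hr
  rcases Nat.mod_two_eq_zero_or_one c with hc | hc <;>
    rcases Nat.mod_two_eq_zero_or_one c' with hc' | hc'
  · omega
  · have := hu.odd_row r c (by omega) hc
    have : v r' (c' + 2) = v r' (c' + 1) := hv.odd_row r' (c' + 1) (by omega) (by omega)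
    omega
  · have : u r (c + 2) = u r (c + 1) := hu.odd_row r (c + 1) (by omega) (by omega)
    have := hv.odd_row r' c' (by omega) hc'
    omega
  · omega

/-- A `3 × 3` window of low bits determines the parity of its position. -/
theorem IsLowBitArray.parity_eq {u v : ℕ → ℕ → ℕ} (hu : IsLowBitArray u) (hv : IsLowBitArray v)
    {r c r' c' : ℕ} (h : ∀ i < 3, ∀ j < 3, u (r + i) (c + j) = v (r' + i) (c' + j)) :
    r % 2 = r' % 2 ∧ c % 2 = c' % 2 := by
  have hr : r % 2 = r' % 2 := hu.row_parity_eq hv (h 0 (by norm_num))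
  refine ⟨hr, ?_⟩
  by_contra hc
  have hu1 (i : ℕ) (hi : i < 3) : (r + i) % 4 ≠ 1 := fun h1 =>
    hc (hu.column_parity_eq hv h1 (h i hi))
  have hv1 (i : ℕ) (hi : i < 3) : (r' + i) % 4 ≠ 1 := fun h1 =>
    hc (hv.column_parity_eq hu h1 fun j hj => (h i hi j hj).symm).symm
  have := hu1 0 (by norm_num)
  have := hu1 1 (by norm_num)
  have := hu1 2 (by norm_num)
  have := hv1 1 (by norm_num)
  have h0 : u r c = v r' c' := h 0 (by norm_num) 0 (by norm_num)
  rw [hu.even_row r c (by omega), hv.even_row r' c' (by omega)] at h0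
  omega

theorem exists_Tfun_window {n : ℕ} (hn : 3 ≤ n) {p : Pat A16 n n} (hp : p ∈ PT n n) :
    ∃ k r c, ∀ i j : Fin n, p i j = Tfun (k + 2) (r + i) (c + j) := by
  obtain ⟨k, r, c, hr, -, h⟩ := Set.mem_iUnion.1 hp
  match k, hr, h with
  | 0, hr, _ => omega
  | 1, hr, _ => omega
  | k + 2, _, h => exact ⟨k, r, c, h⟩

theorem injOn_letterCode_PT {n : ℕ} (hn : 3 ≤ n) :
    Set.InjOn (fun (p : Pat A16 n n) i j => letterCode (p i j)) (PT n n) := by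
  intro p hp q hq h
  obtain ⟨k, r, c, hp⟩ := exists_Tfun_window hn hp
  obtain ⟨l, r', c', hq⟩ := exists_Tfun_window hn hq
  have hcode (i j : Fin n) : letterCode (Tfun (k + 2) (r + i) (c + j)) =
      letterCode (Tfun (l + 2) (r' + i) (c' + j)) := by
    rw [← hp, ← hq]
    exact congrFun (congrFun h i) j
  obtain ⟨hr, hc⟩ := (isLowBitArray_Tfun k).parity_eq (isLowBitArray_Tfun l)
    fun i hi j hj => congrArg (fun a : Fin 4 => a.val % 2)
      (hcode ⟨i, by omega⟩ ⟨j, by omega⟩)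
  ext i j
  rw [hp, hq]
  exact muE_eq_of_letterCode_eq (by omega) (by omega) (hcode i j)

theorem image_letterCode_PT {n : ℕ} (hn : 2 ≤ n) :
    (fun (p : Pat A16 n n) i j => letterCode (p i j)) '' PT n n = PS n n := by
  ext q
  constructor
  · rintro ⟨p, hp, rfl⟩
    obtain ⟨k, r, c, hr, hc, h⟩ := Set.mem_iUnion.1 hp
    cases k with
    | zero => omega
    | succ k =>
      refine Set.mem_iUnion.2 ⟨k, r, c, hr, hc, fun i j => ?_⟩
      rw [Sfun_eq_letterCode_Tfun, ← h]
  · intro hq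
    obtain ⟨k, r, c, hr, hc, h⟩ := Set.mem_iUnion.1 hq
    refine ⟨fun i j => Tfun (k + 1) (r + i) (c + j),
      Set.mem_iUnion.2 ⟨k + 1, r, c, hr, hc, fun _ _ => rfl⟩, ?_⟩
    ext1 i
    ext1 j
    rw [h, Sfun_eq_letterCode_Tfun]

/-- Theorem 3.8: for n ≥ 3, |P(T, n×n)| = |P(S, n×n)|. -/
theorem card_PT_eq_card_PS (n : ℕ) (hn : 3 ≤ n) :
    Nat.card (PT n n) = Nat.card (PS n n) := by
  rw [← image_letterCode_PT (by omega), Nat.card_image_of_injOn (injOn_letterCode_PT hn)]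
end

section
/- For every integer n ≥ 1 the quantities a_{i,j} satisfy: a_{1,1}(4n) = a_{1,1}(2n)+a_{1,2}(2n)+a_{2,1}(2n)+a_{2,2}(2n); a_{1,2}(4n) = 4·a_{1,2}(2n); a_{2,1}(4n) = 2·a_{2,1}(2n)+2·a_{1,2}(2n); a_{2,2}(4n) = 4·a_{1,2}(2n); a_{1,1}(4n+1) = 2·a_{1,1}(2n+1)+2·a_{1,2}(2n); a_{1,2}(4n+1) = a_{2,2}(4n); a_{2,1}(4n+1) = a_{1,1}(2n+1)+a_{1,2}(2n)+a_{1,1}(2n+2)+a_{2,2}(2n+1); a_{2,2}(4n+1) = 2·a_{1,2}(2n)+2·a_{2,2}(2n+1); a_{1,1}(4n+2) = a_{2,1}(4n+1); a_{1,2}(4n+2) = a_{1,2}(2n)+b_{1,2}(2n+1)+a_{2,2}(2n+1)+a_{1,2}(2n+2); a_{2,1}(4n+2) = a_{1,1}(2n+1)+a_{1,2}(2n)+a_{2,1}(2n+2)+a_{2,2}(2n+1); a_{2,2}(4n+2) = a_{1,2}(2n)+b_{1,2}(2n+1)+a_{2,2}(2n+1)+a_{1,2}(2n+2); a_{1,1}(4n+3)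 = a_{1,1}(2n+1)+b_{1,2}(2n+1)+a_{2,1}(2n+2)+a_{1,2}(2n+2); a_{1,2}(4n+3) = a_{2,2}(4n+2); a_{2,1}(4n+3) = a_{1,1}(2n+2)+2·a_{1,2}(2n+2)+a_{2,1}(2n+2); a_{2,2}(4n+3) = 2·a_{2,2}(2n+1)+2·a_{1,2}(2n+2). -/
/-! ### The four bits of a letter -/

def leftBit : A16 → ℕ
  | .I | .J | .K | .L | .M | .N | .O | .P => 1
  | _ => 0

def rightBit : A16 → ℕ
  | .E | .F | .G | .H | .M | .N | .O | .P => 1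
  | _ => 0

def topBit : A16 → ℕ
  | .C | .D | .G | .H | .K | .L | .O | .P => 1
  | _ => 0

def bottomBit : A16 → ℕ
  | .B | .D | .F | .H | .J | .L | .N | .P => 1
  | _ => 0

theorem A16.eq_of_bits {x y : A16} (hl : leftBit x = leftBit y) (hr : rightBit x = rightBit y)
    (ht : topBit x = topBit y) (hb : bottomBit x = bottomBit y) : x = y := by
  cases x <;> cases y <;> first | rfl | (simp [leftBit, rightBit, topBit, bottomBit] at *)

instance : Finite A16 :=
  Finite.of_injective
    (fun x : A16 => (![⟨leftBit x, by cases x <;> decide⟩, ⟨rightBit x, by cases x <;> decide⟩,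
      ⟨topBit x, by cases x <;> decide⟩, ⟨bottomBit x, by cases x <;> decide⟩] : Fin 4 → Fin 2))
    fun x y h => A16.eq_of_bits (congrArg Fin.val (congrFun h 0)) (congrArg Fin.val (congrFun h 1))
      (congrArg Fin.val (congrFun h 2)) (congrArg Fin.val (congrFun h 3))

theorem muE_of_mod {r c r' c' : ℕ} (x : A16) (hr : r % 2 = r' % 2) (hc : c % 2 = c' % 2) :
    muE x r c = muE x r' c' := by
  simp only [muE, hr, hc]

theorem bits_muE (x : A16) (r c : ℕ) :
    leftBit (muE x r c) = (if c % 2 = 0 then leftBit x else rightBit x) ∧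
    rightBit (muE x r c) = (r + c) % 2 ∧
    topBit (muE x r c) = r % 2 ∧
    bottomBit (muE x r c) = (if r % 2 = 0 then (topBit x + c) % 2 else bottomBit x) := by
  rw [muE_of_mod x (Nat.mod_mod r 2).symm (Nat.mod_mod c 2).symm, Nat.add_mod r c,
    Nat.add_mod (topBit x) c]
  rcases Nat.mod_two_eq_zero_or_one r with hr | hr <;>
    rcases Nat.mod_two_eq_zero_or_one c with hc | hc <;> rw [hr, hc] <;> cases x <;> decide

/-! ### The quarter-plane fixed point of the substitution -/

/-- The fixed point of `mu` growing from the letter `A`. -/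
def fixedPoint (r c : ℕ) : A16 :=
  if r = 0 ∧ c = 0 then .A else muE (fixedPoint (r / 2) (c / 2)) r c
termination_by r + c

theorem fixedPoint_zero : fixedPoint 0 0 = .A := by
  rw [fixedPoint]; simp

theorem fixedPoint_eq (r c : ℕ) : fixedPoint r c = muE (fixedPoint (r / 2) (c / 2)) r c := by
  by_cases h : r = 0 ∧ c = 0
  · obtain ⟨rfl, rfl⟩ := h
    simp [fixedPoint_zero, muE, mu]
  · conv_lhs => rw [fixedPoint, if_neg h]

theorem fixedPoint_supertile (k r₀ c₀ r c : ℕ) (hr : r < 2 ^ k) (hc : c < 2 ^ k) :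
    fixedPoint (2 ^ k * r₀ + r) (2 ^ k * c₀ + c) = superE k (fixedPoint r₀ c₀) r c := by
  induction k generalizing r c with
  | zero =>
    obtain rfl : r = 0 := by simpa using hr
    obtain rfl : c = 0 := by simpa using hc
    simp [superE]
  | succ k ih =>
    rw [pow_succ] at hr hc
    have key : ∀ s t : ℕ, (2 ^ (k + 1) * s + t) / 2 = 2 ^ k * s + t / 2 ∧
        (2 ^ (k + 1) * s + t) % 2 = t % 2 := fun s t => by
      have : 2 ^ (k + 1) * s = 2 * (2 ^ k * s) := by ring
      omega
    rw [fixedPoint_eq, (key r₀ r).1, (key c₀ c).1, ih _ _ (by omega) (by omega), superE]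
    exact muE_of_mod _ (key _ _).2 (key _ _).2

theorem superE_add (k l : ℕ) (x : A16) (r₀ c₀ r c : ℕ) (hr : r < 2 ^ k) (hc : c < 2 ^ k) :
    superE (k + l) x (2 ^ k * r₀ + r) (2 ^ k * c₀ + c) = superE k (superE l x r₀ c₀) r c := by
  induction k generalizing r c with
  | zero =>
    obtain rfl : r = 0 := by simpa using hr
    obtain rfl : c = 0 := by simpa using hc
    simp [superE]
  | succ k ih =>
    rw [pow_succ] at hr hc
    have key : ∀ s t : ℕ, (2 ^ (k + 1) * s + t) / 2 = 2 ^ k * s + t / 2 ∧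
        (2 ^ (k + 1) * s + t) % 2 = t % 2 := fun s t => by
      have : 2 ^ (k + 1) * s = 2 * (2 ^ k * s) := by ring
      omega
    rw [Nat.add_right_comm k 1 l, superE, (key r₀ r).1, (key c₀ c).1,
      ih _ _ (by omega) (by omega), superE]
    exact muE_of_mod _ (key _ _).2 (key _ _).2

/-- The `m × n` window of the fixed point with upper-left corner `(r, c)`. -/
def window (m n r c : ℕ) : Pat A16 m n := fun a b => fixedPoint (r + a) (c + b)

theorem PT_eq_range (m n : ℕ) :
    PT m n = Set.range fun x : ℕ × ℕ => window m n x.1 x.2 := by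
  ext p
  simp only [PT, patIn, Tfun, Set.mem_iUnion, Set.mem_ofPred_eq, Set.mem_range, Prod.exists]
  constructor
  · rintro ⟨k, r, c, hr, hc, hp⟩
    refine ⟨2 ^ k * 0 + r, 2 ^ k * 3 + c, ?_⟩
    have hN : fixedPoint 0 3 = .N := by
      rw [fixedPoint_eq, fixedPoint_eq]
      simp [fixedPoint_zero, muE, mu]
    funext a b
    rw [hp, window, add_assoc, add_assoc,
      fixedPoint_supertile _ _ _ _ _ (by omega) (by omega), hN]
  · rintro ⟨r, c, rfl⟩
    obtain ⟨k, hk⟩ : ∃ k, r + m + (c + n) < 2 ^ k := ⟨_, Nat.lt_two_pow_self⟩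
    have hA : superE 3 .N 0 2 = .A := by simp [superE, muE, mu]
    have h3 : 2 ^ (k + 3) = 2 ^ k * 8 := by ring
    refine ⟨k + 3, 2 ^ k * 0 + r, 2 ^ k * 2 + c, by omega, by omega, fun a b => ?_⟩
    rw [window, add_assoc, add_assoc, superE_add _ _ _ _ _ _ _ (by omega) (by omega), hA,
      ← fixedPoint_zero, ← fixedPoint_supertile _ _ _ _ _ (by omega) (by omega)]
    simp

theorem Pij_eq_range {i j m n : ℕ} (hi : i ≤ 1) (hj : j ≤ 1) (hm : 0 < m) (hn : 0 < n) :
    Pij (i + 1) (j + 1) m n =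
      Set.range fun x : ℕ × ℕ => window m n (2 * x.1 + i) (2 * x.2 + j) := by
  have key : ∀ (r c : ℕ) (a : Fin m) (b : Fin n),
      muPatE (window m n r c) (i + 1 - 1 + a) (j + 1 - 1 + b) =
        window m n (2 * r + i) (2 * c + j) a b := fun r c a b => by
    have ha : (i + a) / 2 % m = (i + a) / 2 := Nat.mod_eq_of_lt (by omega)
    have hb : (j + b) / 2 % n = (j + b) / 2 := Nat.mod_eq_of_lt (by omega)
    simp only [muPatE, hm, hn, dif_pos, window, Nat.add_sub_cancel, ha, hb]
    rw [fixedPoint_eq (2 * r + i + a), show (2 * r + i + a) / 2 = r + (i + a) / 2 by omega,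
      show (2 * c + j + b) / 2 = c + (j + b) / 2 by omega]
    exact muE_of_mod _ (by omega) (by omega)
  ext q
  rw [Pij, PT_eq_range]
  constructor
  · rintro ⟨_, ⟨x, rfl⟩, h⟩
    exact ⟨x, funext₂ fun a b => ((h a b).trans (key _ _ a b)).symm⟩
  · rintro ⟨x, rfl⟩
    exact ⟨_, ⟨x, rfl⟩, fun a b => (key _ _ a b).symm⟩

/-! ### Recursions for the left and bottom bits -/

def leftAt (r c : ℕ) : ℕ := leftBit (fixedPoint r c)

def bottomAt (r c : ℕ) : ℕ := bottomBit (fixedPoint r c)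

theorem rightBit_fixedPoint (r c : ℕ) : rightBit (fixedPoint r c) = (r + c) % 2 := by
  rw [fixedPoint_eq, (bits_muE _ _ _).2.1]

theorem topBit_fixedPoint (r c : ℕ) : topBit (fixedPoint r c) = r % 2 := by
  rw [fixedPoint_eq, (bits_muE _ _ _).2.2.1]

theorem leftAt_eq (r c : ℕ) :
    leftAt r c = if c % 2 = 0 then leftAt (r / 2) (c / 2) else (r / 2 + c / 2) % 2 := by
  rw [leftAt, fixedPoint_eq, (bits_muE _ _ _).1, rightBit_fixedPoint, leftAt]

theorem bottomAt_eq (r c : ℕ) :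
    bottomAt r c = if r % 2 = 0 then (r / 2 + c) % 2 else bottomAt (r / 2) (c / 2) := by
  rw [bottomAt, fixedPoint_eq, (bits_muE _ _ _).2.2.2, topBit_fixedPoint, bottomAt,
    Nat.mod_add_mod]

theorem leftAt_lt_two (r c : ℕ) : leftAt r c < 2 := by
  unfold leftAt; cases fixedPoint r c <;> decide

theorem leftAt_of_even {r c s t : ℕ} (hr : r / 2 = s) (hc : c = 2 * t) :
    leftAt r c = leftAt s t := by
  rw [leftAt_eq, if_pos (by omega), hr, show c / 2 = t by omega]

theorem leftAt_of_odd {r c s t : ℕ} (hr : r / 2 = s) (hc : c = 2 * t + 1) :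
    leftAt r c = (s + t) % 2 := by
  rw [leftAt_eq, if_neg (by omega), hr, show c / 2 = t by omega]

theorem bottomAt_of_even {r s : ℕ} (c : ℕ) (hr : r = 2 * s) : bottomAt r c = (s + c) % 2 := by
  rw [bottomAt_eq, if_pos (by omega), show r / 2 = s by omega]

theorem bottomAt_of_odd {r c s t : ℕ} (hr : r = 2 * s + 1) (hc : c / 2 = t) :
    bottomAt r c = bottomAt s t := by
  rw [bottomAt_eq, if_neg (by omega), hc, show r / 2 = s by omega]

/-- The bits around a vertex of the grid have odd sum. -/
theorem vertex_parity (r c : ℕ) :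
    (leftAt r (c + 1) + leftAt (r + 1) (c + 1) + bottomAt r c + bottomAt r (c + 1)) % 2 = 1 := by
  induction r using Nat.strong_induction_on generalizing c with
  | _ r ih =>
    rcases Nat.even_or_odd' r with ⟨s, hr | hr⟩
    · have hl : leftAt (r + 1) (c + 1) = leftAt r (c + 1) := by
        rw [leftAt_eq (r + 1), leftAt_eq r, show (r + 1) / 2 = r / 2 by omega]
      rw [hl, bottomAt_of_even c hr, bottomAt_of_even (c + 1) hr]
      omega
    · rcases Nat.even_or_odd' c with ⟨t, hc | hc⟩
      · rw [bottomAt_of_odd (t := t) hr (by omega), bottomAt_of_odd (t := t) hr (by omega),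
          leftAt_of_odd (s := s) (t := t) (by omega) (by omega),
          leftAt_of_odd (s := s + 1) (t := t) (by omega) (by omega)]
        omega
      · rw [bottomAt_of_odd (t := t) hr (by omega), bottomAt_of_odd (t := t + 1) hr (by omega),
          leftAt_of_even (r := r) (s := s) (t := t + 1) (by omega) (by omega),
          leftAt_of_even (r := r + 1) (s := s + 1) (t := t + 1) (by omega) (by omega)]
        exact ih s (by omega) t

/-! ### The information carried by a window -/

/-- The positions `x` and `y` have the same parities, the same left bits on the rows `a` with
`2 * a < A` and columns in `[j, B)`, and the same bottom bits on the rows `a` with `2 * a + 1 < A`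
and columns in `[0, B)`. -/
def SameData (A j B : ℕ) (x y : ℕ × ℕ) : Prop :=
  x.1 % 2 = y.1 % 2 ∧ x.2 % 2 = y.2 % 2 ∧
    (∀ a b, 2 * a < A → j ≤ b → b < B → leftAt (x.1 + a) (x.2 + b) = leftAt (y.1 + a) (y.2 + b)) ∧
    ∀ a b, 2 * a + 1 < A → b < B → bottomAt (x.1 + a) (x.2 + b) = bottomAt (y.1 + a) (y.2 + b)

theorem window_eq_iff {i j m n : ℕ} (hi : i ≤ 1) (hj : j ≤ 1) (hm : 2 ≤ m) (hn : 2 ≤ n)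
    (x y : ℕ × ℕ) :
    window m n (2 * x.1 + i) (2 * x.2 + j) = window m n (2 * y.1 + i) (2 * y.2 + j) ↔
      SameData (i + m) j ((j + n + 1) / 2) x y := by
  constructor
  · intro h
    have hW : ∀ a b, a < m → b < n → fixedPoint (2 * x.1 + i + a) (2 * x.2 + j + b) =
        fixedPoint (2 * y.1 + i + a) (2 * y.2 + j + b) :=
      fun a b ha hb => congrFun (congrFun h ⟨a, ha⟩) ⟨b, hb⟩
    have hL : ∀ a b, a < m → b < n → leftAt (2 * x.1 + i + a) (2 * x.2 + j + b) =
        leftAt (2 * y.1 + i + a) (2 * y.2 + j + b) :=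
      fun a b ha hb => congrArg leftBit (hW a b ha hb)
    have hB : ∀ a b, a < m → b < n → bottomAt (2 * x.1 + i + a) (2 * x.2 + j + b) =
        bottomAt (2 * y.1 + i + a) (2 * y.2 + j + b) :=
      fun a b ha hb => congrArg bottomBit (hW a b ha hb)
    have h1 := hB i 0 (by omega) (by omega)
    rw [bottomAt_of_even (s := x.1 + i) _ (by omega),
      bottomAt_of_even (s := y.1 + i) _ (by omega)] at h1
    have h2 := hL 0 (1 - j) (by omega) (by omega)
    rw [leftAt_of_odd (s := x.1) (t := x.2) (by omega) (by omega),
      leftAt_of_odd (s := y.1) (t := y.2) (by omega) (by omega)] at h2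
    refine ⟨by omega, by omega, fun a b ha hb hb' => ?_, fun a b ha hb => ?_⟩
    · have := hL (2 * a - i) (2 * b - j) (by omega) (by omega)
      exact ((leftAt_of_even (by omega) (by omega)).symm.trans this).trans
        (leftAt_of_even (by omega) (by omega))
    · have := hB (2 * a + 1 - i) (2 * b - j) (by omega) (by omega)
      exact ((bottomAt_of_odd (by omega) (by omega)).symm.trans this).trans
        (bottomAt_of_odd (by omega) (by omega))
  · rintro ⟨h1, h2, hL, hB⟩
    funext ⟨a, ha⟩ ⟨b, hb⟩
    simp only [window]
    refine A16.eq_of_bits ?_ ?_ ?_ ?_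
    · change leftAt _ _ = leftAt _ _
      rcases Nat.even_or_odd' (j + b) with ⟨t, ht | ht⟩
      · exact (leftAt_of_even (s := x.1 + (i + a) / 2) (t := x.2 + t) (by omega) (by omega)).trans
          ((hL _ _ (by omega) (by omega) (by omega)).trans (leftAt_of_even (s := y.1 + (i + a) / 2) (t := y.2 + t) (by omega) (by omega)).symm)
      · rw [leftAt_of_odd (s := x.1 + (i + a) / 2) (t := x.2 + t) (by omega) (by omega),
          leftAt_of_odd (s := y.1 + (i + a) / 2) (t := y.2 + t) (by omega) (by omega)]
        omega
    · rw [rightBit_fixedPoint, rightBit_fixedPoint]; omega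
    · rw [topBit_fixedPoint, topBit_fixedPoint]; omega
    · change bottomAt _ _ = bottomAt _ _
      rcases Nat.even_or_odd' (i + a) with ⟨s, hs | hs⟩
      · rw [bottomAt_of_even (s := x.1 + s) _ (by omega),
          bottomAt_of_even (s := y.1 + s) _ (by omega)]
        omega
      · exact (bottomAt_of_odd (s := x.1 + s) (t := x.2 + (j + b) / 2) (by omega) (by omega)).trans
          ((hB _ _ (by omega) (by omega)).trans (bottomAt_of_odd (s := y.1 + s) (t := y.2 + (j + b) / 2) (by omega) (by omega)).symm)

theorem sameData_double_iff {A A' j j' B B' p q : ℕ} (hp : p ≤ 1) (hq : q ≤ 1)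
    (hA : 4 ≤ A) (hB : j + 2 ≤ B) (hup : (A' + 1) / 2 = (p + (A + 1) / 2 + 1) / 2)
    (hdown : A' / 2 = (p + A / 2) / 2) (hj : j ≤ 1) (hj' : j' = max q j)
    (hB' : B' = (q + B + 1) / 2) (x y : ℕ × ℕ) :
    SameData A j B (2 * x.1 + p, 2 * x.2 + q) (2 * y.1 + p, 2 * y.2 + q) ↔
      SameData A' j' B' x y := by
  constructor
  · rintro ⟨-, -, hL, hb⟩
    simp only at hL hb
    have h1 := hb p 0 (by omega) (by omega)
    rw [bottomAt_of_even (s := x.1 + p) _ (by omega),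
      bottomAt_of_even (s := y.1 + p) _ (by omega)] at h1
    obtain ⟨b, t, hjb, hbB, hbt⟩ : ∃ b t, j ≤ b ∧ b < B ∧ q + b = 2 * t + 1 := by
      rcases Nat.even_or_odd' (q + j) with ⟨t, ht | ht⟩
      · exact ⟨j + 1, t, by omega, by omega, by omega⟩
      · exact ⟨j, t, by omega, by omega, by omega⟩
    have h2 := hL 0 b (by omega) hjb hbB
    rw [leftAt_of_odd (s := x.1) (t := x.2 + t) (by omega) (by omega),
      leftAt_of_odd (s := y.1) (t := y.2 + t) (by omega) (by omega)] at h2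
    refine ⟨by omega, by omega, fun a b ha hb hb' => ?_, fun a b ha hb' => ?_⟩
    · have := hL (2 * a - p) (2 * b - q) (by omega) (by omega) (by omega)
      exact ((leftAt_of_even (by omega) (by omega)).symm.trans this).trans
        (leftAt_of_even (by omega) (by omega))
    · have := hb (2 * a + 1 - p) (2 * b - q) (by omega) (by omega)
      exact ((bottomAt_of_odd (by omega) (by omega)).symm.trans this).trans
        (bottomAt_of_odd (by omega) (by omega))
  · rintro ⟨h1, h2, hL, hb⟩
    refine ⟨by simp only; omega, by simp only; omega, fun a b ha hjb hbB => ?_,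
      fun a b ha hbB => ?_⟩ <;> simp only
    · rcases Nat.even_or_odd' (q + b) with ⟨t, ht | ht⟩
      · exact (leftAt_of_even (s := x.1 + (p + a) / 2) (t := x.2 + t) (by omega) (by omega)).trans
          ((hL _ _ (by omega) (by omega) (by omega)).trans (leftAt_of_even (s := y.1 + (p + a) / 2) (t := y.2 + t) (by omega) (by omega)).symm)
      · rw [leftAt_of_odd (s := x.1 + (p + a) / 2) (t := x.2 + t) (by omega) (by omega),
          leftAt_of_odd (s := y.1 + (p + a) / 2) (t := y.2 + t) (by omega) (by omega)]
        omega
    · rcases Nat.even_or_odd' (p + a) with ⟨s, hs | hs⟩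
      · rw [bottomAt_of_even (s := x.1 + s) _ (by omega),
          bottomAt_of_even (s := y.1 + s) _ (by omega)]
        omega
      · exact (bottomAt_of_odd (s := x.1 + s) (t := x.2 + (q + b) / 2) (by omega) (by omega)).trans
          ((hb _ _ (by omega) (by omega)).trans (bottomAt_of_odd (s := y.1 + s) (t := y.2 + (q + b) / 2) (by omega) (by omega)).symm)

/-- When the first column is incomplete, the last row of left bits is redundant. -/
theorem sameData_odd_iff {k B : ℕ} (hk : 1 ≤ k) (x y : ℕ × ℕ) :
    SameData (2 * k + 1) 1 B x y ↔ SameData (2 * k) 1 B x y := by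
  constructor
  · rintro ⟨h1, h2, hL, hb⟩
    exact ⟨h1, h2, fun a b ha => hL a b (by omega), fun a b ha => hb a b (by omega)⟩
  · rintro ⟨h1, h2, hL, hb⟩
    refine ⟨h1, h2, fun a b ha hb1 hbB => ?_, fun a b ha => hb a b (by omega)⟩
    rcases Nat.lt_or_ge a k with hak | hak
    · exact hL a b (by omega) hb1 hbB
    · obtain ⟨l, rfl⟩ : ∃ l, a = l + 1 := ⟨a - 1, by omega⟩
      obtain ⟨d, rfl⟩ : ∃ d, b = d + 1 := ⟨b - 1, by omega⟩
      have e1 := hL l (d + 1) (by omega) hb1 hbB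
      have e2 := hb l d (by omega) (by omega)
      have e3 := hb l (d + 1) (by omega) hbB
      have vx := vertex_parity (x.1 + l) (x.2 + d)
      have vy := vertex_parity (y.1 + l) (y.2 + d)
      have := leftAt_lt_two (x.1 + (l + 1)) (x.2 + (d + 1))
      have := leftAt_lt_two (y.1 + (l + 1)) (y.2 + (d + 1))
      simp only [← add_assoc] at *
      omega

/-! ### Counting windows -/

theorem card_range_congr {ι α β : Type*} {F : ι → α} {G : ι → β}
    (h : ∀ x y, F x = F y ↔ G x = G y) :
    Nat.card (Set.range F) = Nat.card (Set.range G) := by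
  have hker : Setoid.ker F = Setoid.ker G := Setoid.ext h
  exact Nat.card_congr ((Setoid.quotientKerEquivRange F).symm.trans
    ((Quotient.congrRight fun x y => by rw [hker]).trans (Setoid.quotientKerEquivRange G)))

theorem card_range_split {α : Type*} [Finite α] (F : ℕ × ℕ → α)
    (h : ∀ x y, F x = F y → x.1 % 2 = y.1 % 2 ∧ x.2 % 2 = y.2 % 2) :
    Nat.card (Set.range F) =
      Nat.card (Set.range fun x : ℕ × ℕ => F (2 * x.1 + 0, 2 * x.2 + 0)) +
      Nat.card (Set.range fun x : ℕ × ℕ => F (2 * x.1 + 0, 2 * x.2 + 1)) +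
      Nat.card (Set.range fun x : ℕ × ℕ => F (2 * x.1 + 1, 2 * x.2 + 0)) +
      Nat.card (Set.range fun x : ℕ × ℕ => F (2 * x.1 + 1, 2 * x.2 + 1)) := by
  have hU : Set.range F =
      ((Set.range (fun x : ℕ × ℕ => F (2 * x.1 + 0, 2 * x.2 + 0)) ∪
        Set.range fun x : ℕ × ℕ => F (2 * x.1 + 0, 2 * x.2 + 1)) ∪
        Set.range fun x : ℕ × ℕ => F (2 * x.1 + 1, 2 * x.2 + 0)) ∪
        Set.range fun x : ℕ × ℕ => F (2 * x.1 + 1, 2 * x.2 + 1) := by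
    ext z
    constructor
    · rintro ⟨⟨r, c⟩, rfl⟩
      rcases Nat.even_or_odd' r with ⟨s, rfl | rfl⟩ <;>
        rcases Nat.even_or_odd' c with ⟨t, rfl | rfl⟩
      · exact Or.inl (Or.inl (Or.inl ⟨(s, t), rfl⟩))
      · exact Or.inl (Or.inl (Or.inr ⟨(s, t), rfl⟩))
      · exact Or.inl (Or.inr ⟨(s, t), rfl⟩)
      · exact Or.inr ⟨(s, t), rfl⟩
    · rintro (((⟨x, rfl⟩ | ⟨x, rfl⟩) | ⟨x, rfl⟩) | ⟨x, rfl⟩) <;> exact ⟨_, rfl⟩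
  simp only [Nat.card_coe_set_eq]
  rw [hU, Set.ncard_union_eq, Set.ncard_union_eq, Set.ncard_union_eq]
  all_goals
    rw [Set.disjoint_left]
    simp only [Set.mem_union, Set.mem_range]
  · rintro _ ⟨x, rfl⟩ ⟨y, hy⟩
    have := h _ _ hy; omega
  · rintro _ (⟨x, rfl⟩ | ⟨x, rfl⟩) ⟨y, hy⟩ <;> (have := h _ _ hy; omega)
  · rintro _ ((⟨x, rfl⟩ | ⟨x, rfl⟩) | ⟨x, rfl⟩) ⟨y, hy⟩ <;> (have := h _ _ hy; omega)

/-- The number of windows with `A` rows starting at an even row, and columns from `j` to `2 * B`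
relative to an even column. -/
noncomputable def windowCount (A j B : ℕ) : ℕ :=
  Nat.card (Set.range fun x : ℕ × ℕ => window A (2 * B - j) (2 * x.1 + 0) (2 * x.2 + j))

theorem normal_window_eq_iff {A j B : ℕ} (hA : 2 ≤ A) (hj : j ≤ 1) (hB : j + 1 ≤ B)
    (x y : ℕ × ℕ) :
    window A (2 * B - j) (2 * x.1 + 0) (2 * x.2 + j) =
        window A (2 * B - j) (2 * y.1 + 0) (2 * y.2 + j) ↔ SameData A j B x y := by
  rw [window_eq_iff (Nat.zero_le 1) hj hA (by omega), zero_add,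
    show (j + (2 * B - j) + 1) / 2 = B by omega]

theorem card_Pij {i j m n A B : ℕ} (hi : i ≤ 1) (hj : j ≤ 1) (hm : 2 ≤ m) (hn : 2 ≤ n)
    (hA : A = i + m) (hB : B = (j + n + 1) / 2) :
    Nat.card (Pij (i + 1) (j + 1) m n) = windowCount A j B := by
  rw [Pij_eq_range hi hj (by omega) (by omega), windowCount]
  refine card_range_congr fun x y => ?_
  rw [window_eq_iff hi hj hm hn, normal_window_eq_iff (by omega) hj (by omega), hA, hB]

theorem windowCount_odd {k B : ℕ} (hk : 1 ≤ k) (hB : 2 ≤ B) :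
    windowCount (2 * k + 1) 1 B = windowCount (2 * k) 1 B := by
  refine card_range_congr fun x y => ?_
  rw [normal_window_eq_iff (by omega) le_rfl hB, normal_window_eq_iff (by omega) le_rfl hB,
    sameData_odd_iff hk]

theorem windowCount_rec {A j B : ℕ} (A₀ A₁ B₀ B₁ : ℕ) (hA : 4 ≤ A) (hj : j ≤ 1) (hB : j + 2 ≤ B)
    (hA₀ : A₀ = ((A + 1) / 2 + 1) / 2 + A / 2 / 2)
    (hA₁ : A₁ = ((A + 1) / 2 + 2) / 2 + (A / 2 + 1) / 2)
    (hB₀ : B₀ = (B + 1) / 2) (hB₁ : B₁ = (B + 2) / 2) :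
    windowCount A j B = windowCount A₀ j B₀ + windowCount A₀ 1 B₁ + windowCount A₁ j B₀ +
      windowCount A₁ 1 B₁ := by
  have split := card_range_split
    (fun x : ℕ × ℕ => window A (2 * B - j) (2 * x.1 + 0) (2 * x.2 + j)) fun x y hxy => by
      have := (normal_window_eq_iff (by omega) hj (by omega) x y).1 hxy
      exact ⟨this.1, this.2.1⟩
  rw [windowCount, split]
  have part : ∀ p q A' j' B' : ℕ, p ≤ 1 → q ≤ 1 → (A' + 1) / 2 = (p + (A + 1) / 2 + 1) / 2 →
      A' / 2 = (p + A / 2) / 2 → j' = max q j → B' = (q + B + 1) / 2 →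
      Nat.card (Set.range fun x : ℕ × ℕ => window A (2 * B - j) (2 * (2 * x.1 + p) + 0)
        (2 * (2 * x.2 + q) + j)) = windowCount A' j' B' := by
    intro p q A' j' B' hp hq h1 h2 hj' hB'
    refine card_range_congr fun x y => ?_
    rw [normal_window_eq_iff (by omega) (by omega) (by omega),
      ← sameData_double_iff hp hq hA hB h1 h2 hj hj' hB']
    exact normal_window_eq_iff (by omega) hj (by omega) (2 * x.1 + p, 2 * x.2 + q)
      (2 * y.1 + p, 2 * y.2 + q)
  rw [part 0 0 A₀ j B₀, part 0 1 A₀ 1 B₁, part 1 0 A₁ j B₀, part 1 1 A₁ 1 B₁] <;> omega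

/-- The system of recursions for the quantities a_{i,j}. -/
theorem recursion_system_a (n : ℕ) (hn : 1 ≤ n) :
    (aT 1 1 (4 * n) =
        aT 1 1 (2 * n) + aT 1 2 (2 * n) + aT 2 1 (2 * n) + aT 2 2 (2 * n)) ∧
    (aT 1 2 (4 * n) = 4 * aT 1 2 (2 * n)) ∧
    (aT 2 1 (4 * n) = 2 * aT 2 1 (2 * n) + 2 * aT 1 2 (2 * n)) ∧
    (aT 2 2 (4 * n) = 4 * aT 1 2 (2 * n)) ∧
    (aT 1 1 (4 * n + 1) = 2 * aT 1 1 (2 * n + 1) + 2 * aT 1 2 (2 * n)) ∧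
    (aT 1 2 (4 * n + 1) = aT 2 2 (4 * n)) ∧
    (aT 2 1 (4 * n + 1) =
        aT 1 1 (2 * n + 1) + aT 1 2 (2 * n) + aT 1 1 (2 * n + 2) +
          aT 2 2 (2 * n + 1)) ∧
    (aT 2 2 (4 * n + 1) = 2 * aT 1 2 (2 * n) + 2 * aT 2 2 (2 * n + 1)) ∧
    (aT 1 1 (4 * n + 2) = aT 2 1 (4 * n + 1)) ∧
    (aT 1 2 (4 * n + 2) =
        aT 1 2 (2 * n) + bT 1 2 (2 * n + 1) + aT 2 2 (2 * n + 1) +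
          aT 1 2 (2 * n + 2)) ∧
    (aT 2 1 (4 * n + 2) =
        aT 1 1 (2 * n + 1) + aT 1 2 (2 * n) + aT 2 1 (2 * n + 2) +
          aT 2 2 (2 * n + 1)) ∧
    (aT 2 2 (4 * n + 2) =
        aT 1 2 (2 * n) + bT 1 2 (2 * n + 1) + aT 2 2 (2 * n + 1) +
          aT 1 2 (2 * n + 2)) ∧
    (aT 1 1 (4 * n + 3) =
        aT 1 1 (2 * n + 1) + bT 1 2 (2 * n + 1) + aT 2 1 (2 * n + 2) +
          aT 1 2 (2 * n + 2)) ∧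
    (aT 1 2 (4 * n + 3) = aT 2 2 (4 * n + 2)) ∧
    (aT 2 1 (4 * n + 3) =
        aT 1 1 (2 * n + 2) + 2 * aT 1 2 (2 * n + 2) + aT 2 1 (2 * n + 2)) ∧
    (aT 2 2 (4 * n + 3) = 2 * aT 2 2 (2 * n + 1) + 2 * aT 1 2 (2 * n + 2)) := by
  have a11 : ∀ m A B, 2 ≤ m → A = m → B = (m + 1) / 2 → aT 1 1 m = windowCount A 0 B :=
    fun m A B hm hA hB => card_Pij (i := 0) (j := 0) (by omega) (by omega) hm hm
      (by omega) (by omega)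
  have a12 : ∀ m A B, 2 ≤ m → A = m → B = (m + 2) / 2 → aT 1 2 m = windowCount A 1 B :=
    fun m A B hm hA hB => card_Pij (i := 0) (j := 1) (by omega) (by omega) hm hm
      (by omega) (by omega)
  have a21 : ∀ m A B, 2 ≤ m → A = m + 1 → B = (m + 1) / 2 → aT 2 1 m = windowCount A 0 B :=
    fun m A B hm hA hB => card_Pij (i := 1) (j := 0) (by omega) (by omega) hm hm
      (by omega) (by omega)
  have a22 : ∀ m A B, 2 ≤ m → A = m + 1 → B = (m + 2) / 2 → aT 2 2 m = windowCount A 1 B :=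
    fun m A B hm hA hB => card_Pij (i := 1) (j := 1) (by omega) (by omega) hm hm
      (by omega) (by omega)
  have b12 : bT 1 2 (2 * n + 1) = windowCount (2 * n + 1) 1 (n + 2) :=
    card_Pij (i := 0) (j := 1) (by omega) (by omega) (by omega) (by omega) (by omega) (by omega)
  rw [a11 (4 * n) (4 * n) (2 * n) (by omega) (by omega) (by omega),
    a11 (4 * n + 1) (4 * n + 1) (2 * n + 1) (by omega) (by omega) (by omega),
    a11 (4 * n + 2) (4 * n + 2) (2 * n + 1) (by omega) (by omega) (by omega),
    a11 (4 * n + 3) (4 * n + 3) (2 * n + 2) (by omega) (by omega) (by omega),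
    a11 (2 * n) (2 * n) n (by omega) (by omega) (by omega),
    a11 (2 * n + 1) (2 * n + 1) (n + 1) (by omega) (by omega) (by omega),
    a11 (2 * n + 2) (2 * n + 2) (n + 1) (by omega) (by omega) (by omega),
    a12 (4 * n) (4 * n) (2 * n + 1) (by omega) (by omega) (by omega),
    a12 (4 * n + 1) (4 * n + 1) (2 * n + 1) (by omega) (by omega) (by omega),
    a12 (4 * n + 2) (4 * n + 2) (2 * n + 2) (by omega) (by omega) (by omega),
    a12 (4 * n + 3) (4 * n + 3) (2 * n + 2) (by omega) (by omega) (by omega),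
    a12 (2 * n) (2 * n) (n + 1) (by omega) (by omega) (by omega),
    a12 (2 * n + 2) (2 * n + 2) (n + 2) (by omega) (by omega) (by omega),
    a21 (4 * n) (4 * n + 1) (2 * n) (by omega) (by omega) (by omega),
    a21 (4 * n + 1) (4 * n + 2) (2 * n + 1) (by omega) (by omega) (by omega),
    a21 (4 * n + 2) (4 * n + 3) (2 * n + 1) (by omega) (by omega) (by omega),
    a21 (4 * n + 3) (4 * n + 4) (2 * n + 2) (by omega) (by omega) (by omega),
    a21 (2 * n) (2 * n + 1) n (by omega) (by omega) (by omega),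
    a21 (2 * n + 2) (2 * n + 3) (n + 1) (by omega) (by omega) (by omega),
    a22 (4 * n) (4 * n + 1) (2 * n + 1) (by omega) (by omega) (by omega),
    a22 (4 * n + 1) (4 * n + 2) (2 * n + 1) (by omega) (by omega) (by omega),
    a22 (4 * n + 2) (4 * n + 3) (2 * n + 2) (by omega) (by omega) (by omega),
    a22 (4 * n + 3) (4 * n + 4) (2 * n + 2) (by omega) (by omega) (by omega),
    a22 (2 * n) (2 * n + 1) (n + 1) (by omega) (by omega) (by omega),
    a22 (2 * n + 1) (2 * n + 2) (n + 1) (by omega) (by omega) (by omega),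
    b12]
  rw [windowCount_rec (A := 4 * n) (j := 0) (B := 2 * n)
      (2 * n) (2 * n + 1) n (n + 1)
      (by omega) (by omega) (by omega) (by omega) (by omega) (by omega) (by omega),
    windowCount_rec (A := 4 * n + 1) (j := 0) (B := 2 * n + 1)
      (2 * n + 1) (2 * n + 1) (n + 1) (n + 1)
      (by omega) (by omega) (by omega) (by omega) (by omega) (by omega) (by omega),
    windowCount_rec (A := 4 * n + 2) (j := 0) (B := 2 * n + 1)
      (2 * n + 1) (2 * n + 2) (n + 1) (n + 1)
      (by omega) (by omega) (by omega) (by omega) (by omega) (by omega) (by omega),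
    windowCount_rec (A := 4 * n + 3) (j := 0) (B := 2 * n + 2)
      (2 * n + 1) (2 * n + 3) (n + 1) (n + 2)
      (by omega) (by omega) (by omega) (by omega) (by omega) (by omega) (by omega),
    windowCount_rec (A := 4 * n) (j := 1) (B := 2 * n + 1)
      (2 * n) (2 * n + 1) (n + 1) (n + 1)
      (by omega) (by omega) (by omega) (by omega) (by omega) (by omega) (by omega),
    windowCount_rec (A := 4 * n + 1) (j := 1) (B := 2 * n + 1)
      (2 * n + 1) (2 * n + 1) (n + 1) (n + 1)
      (by omega) (by omega) (by omega) (by omega) (by omega) (by omega) (by omega),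
    windowCount_rec (A := 4 * n + 2) (j := 1) (B := 2 * n + 2)
      (2 * n + 1) (2 * n + 2) (n + 1) (n + 2)
      (by omega) (by omega) (by omega) (by omega) (by omega) (by omega) (by omega),
    windowCount_rec (A := 4 * n + 3) (j := 1) (B := 2 * n + 2)
      (2 * n + 1) (2 * n + 3) (n + 1) (n + 2)
      (by omega) (by omega) (by omega) (by omega) (by omega) (by omega) (by omega),
    windowCount_rec (A := 4 * n + 1) (j := 0) (B := 2 * n)
      (2 * n + 1) (2 * n + 1) n (n + 1)
      (by omega) (by omega) (by omega) (by omega) (by omega) (by omega) (by omega),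
    windowCount_rec (A := 4 * n + 3) (j := 0) (B := 2 * n + 1)
      (2 * n + 1) (2 * n + 3) (n + 1) (n + 1)
      (by omega) (by omega) (by omega) (by omega) (by omega) (by omega) (by omega),
    windowCount_rec (A := 4 * n + 4) (j := 0) (B := 2 * n + 2)
      (2 * n + 2) (2 * n + 3) (n + 1) (n + 2)
      (by omega) (by omega) (by omega) (by omega) (by omega) (by omega) (by omega),
    windowCount_rec (A := 4 * n + 2) (j := 1) (B := 2 * n + 1)
      (2 * n + 1) (2 * n + 2) (n + 1) (n + 1)
      (by omega) (by omega) (by omega) (by omega) (by omega) (by omega) (by omega),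
    windowCount_rec (A := 4 * n + 4) (j := 1) (B := 2 * n + 2)
      (2 * n + 2) (2 * n + 3) (n + 1) (n + 2)
      (by omega) (by omega) (by omega) (by omega) (by omega) (by omega) (by omega),
    windowCount_odd (k := n) (B := n + 1) (by omega) (by omega),
    show 2 * n + 3 = 2 * (n + 1) + 1 by omega, show 2 * n + 2 = 2 * (n + 1) by omega,
    windowCount_odd (k := n + 1) (B := n + 1) (by omega) (by omega),
    windowCount_odd (k := n + 1) (B := n + 2) (by omega) (by omega)]
  refine ⟨?_, ?_, ?_, ?_, ?_, ?_, ?_, ?_, ?_, ?_, ?_, ?_, ?_, ?_, ?_, ?_⟩ <;> omega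
end
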